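/- arXiv:2104.02670 — 6 statements merged into one kernel-verified Lean document; each statement's English description precedes it below -/
import Mathlib

section
/- Let φ be a Drinfeld module of rank r over 𝕂 given by φ_t = θ + A_1 τ + ⋯ + A_r τ^r. Given any nonzero y_1 ∈ φ[t], there exist y_2, y_3, … ∈ 𝕂 such that: (1) φ_t(y_k) = y_{k−1} for all k ≥ 2; (2) deg y_1 > deg y_2 > deg y_3 > ⋯ (indeed deg y_{k+1} ≤ deg y_k − 1 for all k); (3) there exists a positive integer N with |y_N| < R_φ; (4) deg y_k → −∞ as k → ∞; and (5) for every k ≥ N, y_{k+1} is the unique root of φ_t(x) − y_k of degree deg y_k − 1, and every other root of φ_t(x) − y_k has strictly larger degree, so that for k ≥ N the sequence is uniquely determined by y_N. -/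
open Filter

set_option maxHeartbeats 1000000
set_option synthInstance.maxHeartbeats 400000

noncomputable section

namespace DrinfeldRAT

variable (𝕂 : Type) [NontriviallyNormedField 𝕂]

/-- `deg x := log_q ‖x‖`. -/
def degK (q : ℕ) (x : 𝕂) : ℝ := Real.logb q ‖x‖

/-- The action of `φ_t` on `𝕂`: `φ_t(x) = θ x + A_1 x^q + ⋯ + A_r x^{q^r}`. -/
def phiT (q r : ℕ) (θ : 𝕂) (A : ℕ → 𝕂) (x : 𝕂) : 𝕂 :=
  θ * x + ∑ i ∈ Finset.Icc 1 r, A i * x ^ q ^ i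

/-- Membership in `N(φ) = {1 ≤ i ≤ r : A_i ≠ 0}`. -/
def inNphi (r : ℕ) (A : ℕ → 𝕂) (i : ℕ) : Prop := 1 ≤ i ∧ i ≤ r ∧ A i ≠ 0

/-- `μ_n = (deg A_n − q^n)/(q^n − 1)`. -/
def muPhi (q : ℕ) (A : ℕ → 𝕂) (n : ℕ) : ℝ :=
  (degK 𝕂 q (A n) - (q : ℝ) ^ n) / ((q : ℝ) ^ n - 1)

/-- `m` is the smallest index in `N(φ)` at which `μ` is maximal on `N(φ)`. -/
def IsMuIndex (q r : ℕ) (A : ℕ → 𝕂) (m : ℕ) : Prop :=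
  inNphi 𝕂 r A m ∧ (∀ i, inNphi 𝕂 r A i → muPhi 𝕂 q A i ≤ muPhi 𝕂 q A m) ∧
    ∀ m', inNphi 𝕂 r A m' → (∀ i, inNphi 𝕂 r A i → muPhi 𝕂 q A i ≤ muPhi 𝕂 q A m') → m ≤ m'

/-- `R_φ = q^{−μ_m}` (a real power). -/
def Rphi (q : ℕ) (A : ℕ → 𝕂) (m : ℕ) : ℝ := (q : ℝ) ^ (-(muPhi 𝕂 q A m))

/-- The coefficient of `x^{q^n}` in `φ_t(x)`, with `A₀ = θ`. -/
def Acoef (θ : 𝕂) (A : ℕ → 𝕂) (n : ℕ) : 𝕂 := if n = 0 then θ else A n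

/-- Data of the Newton polygon of `φ_t(x)`: vertices `(q^{d_j}, −deg A_{d_j})`,
`0 = d_0 < d_1 < ⋯ < d_s = r`, with strictly increasing edge slopes `λ_1 < ⋯ < λ_s`,
such that every point `(q^n, −deg A_n)` (for `A_n ≠ 0`, including `n = 0`) lies on or
above each edge line (lower convex hull). -/
structure NewtonData (q r : ℕ) (θ : 𝕂) (A : ℕ → 𝕂) where
  s : ℕ
  d : ℕ → ℕ
  lam : ℕ → ℝ
  s_pos : 0 < s
  d_zero : d 0 = 0
  d_last : d s = r
  d_mono : ∀ j < s, d j < d (j + 1)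
  vertex_ne : ∀ j, 1 ≤ j → j ≤ s → A (d j) ≠ 0
  slope_eq : ∀ j, 1 ≤ j → j ≤ s →
    lam j = (degK 𝕂 q (Acoef 𝕂 θ A (d (j - 1))) - degK 𝕂 q (Acoef 𝕂 θ A (d j))) /
      ((q : ℝ) ^ d j - (q : ℝ) ^ d (j - 1))
  lam_mono : ∀ j, 1 ≤ j → j + 1 ≤ s → lam j < lam (j + 1)
  hull : ∀ n ≤ r, Acoef 𝕂 θ A n ≠ 0 → ∀ j, 1 ≤ j → j ≤ s →
    lam j * ((q : ℝ) ^ n - (q : ℝ) ^ d j) + (-(degK 𝕂 q (Acoef 𝕂 θ A (d j)))) ≤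
      -(degK 𝕂 q (Acoef 𝕂 θ A n))

/-- `x 0, …, x (r−1)` is an `𝔽_q`-basis of `φ[t]` (`𝔽_q ⊆ 𝕂` is the set of `c` with `c^q = c`). -/
def IsFqBasis (q r : ℕ) (θ : 𝕂) (A : ℕ → 𝕂) (x : Fin r → 𝕂) : Prop :=
  (∀ j, phiT 𝕂 q r θ A (x j) = 0) ∧
    ∀ y, phiT 𝕂 q r θ A y = 0 →
      ∃! c : Fin r → 𝕂, (∀ j, c j ^ q = c j) ∧ y = ∑ j, c j * x j

/-- Strictness of a basis of `φ[t]` with respect to Newton polygon data: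
`deg x_j = λ_k` for `d_{k−1} < j ≤ d_k` (here `x` is indexed from `0`). -/
def IsStrict (q r : ℕ) (θ : 𝕂) (A : ℕ → 𝕂) (ND : NewtonData 𝕂 q r θ A)
    (x : Fin r → 𝕂) : Prop :=
  ∀ k, 1 ≤ k → k ≤ ND.s → ∀ j : Fin r, ND.d (k - 1) ≤ (j : ℕ) → (j : ℕ) < ND.d k →
    degK 𝕂 q (x j) = ND.lam k

/-- The conditions of Proposition `good-xi` on `ξ_1, …, ξ_r ∈ φ[t^N]`:
`|ξ_j| < R_φ`, `φ_{t^{N−1}}(ξ_j) = x_j`, and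
`deg φ_{t^{N−1}}(ξ_j) > ⋯ > deg φ_t(ξ_j) > deg ξ_j`. -/
def GoodXi (q r N : ℕ) (θ : 𝕂) (A : ℕ → 𝕂) (m : ℕ) (x ξ : Fin r → 𝕂) : Prop :=
  ∀ j, (phiT 𝕂 q r θ A)^[N] (ξ j) = 0 ∧
    ‖ξ j‖ < Rphi 𝕂 q A m ∧
    (phiT 𝕂 q r θ A)^[N - 1] (ξ j) = x j ∧
    ∀ i, i + 1 ≤ N - 1 →
      degK 𝕂 q ((phiT 𝕂 q r θ A)^[i] (ξ j)) < degK 𝕂 q ((phiT 𝕂 q r θ A)^[i + 1] (ξ j))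

/-- Gauss norm of a power series. -/
def gnorm (f : PowerSeries 𝕂) : ℝ := ⨆ i : ℕ, ‖PowerSeries.coeff i f‖

/-- Membership in the Tate algebra `𝕋`: coefficients tend to `0`. -/
def IsTate (f : PowerSeries 𝕂) : Prop :=
  Tendsto (fun i => ‖PowerSeries.coeff i f‖) atTop (nhds 0)

/-- `n`-th Frobenius twist of a power series: coefficients raised to the `q^n` power. -/
def twist (q n : ℕ) (f : PowerSeries 𝕂) : PowerSeries 𝕂 :=
  PowerSeries.mk fun i => PowerSeries.coeff i f ^ q ^ n

/-- Entrywise Frobenius twist of a matrix of power series. -/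
def twistM {r : ℕ} (q n : ℕ) (M : Matrix (Fin r) (Fin r) (PowerSeries 𝕂)) :
    Matrix (Fin r) (Fin r) (PowerSeries 𝕂) :=
  Matrix.of fun i j => twist 𝕂 q n (M i j)

/-- Gauss norm of a matrix: maximum of the Gauss norms of the entries. -/
def mnorm {r : ℕ} (M : Matrix (Fin r) (Fin r) (PowerSeries 𝕂)) : ℝ :=
  ⨆ p : Fin r × Fin r, gnorm 𝕂 (M p.1 p.2)

/-- Membership in `GL_r(𝕋)`: all entries in `𝕋` and two-sided inverse with entries in `𝕋`. -/
def MemGLT {r : ℕ} (M : Matrix (Fin r) (Fin r) (PowerSeries 𝕂)) : Prop :=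
  (∀ i j, IsTate 𝕂 (M i j)) ∧
    ∃ C : Matrix (Fin r) (Fin r) (PowerSeries 𝕂),
      (∀ i j, IsTate 𝕂 (C i j)) ∧ M * C = 1 ∧ C * M = 1

/-- The matrix `Θ`, with entries viewed in `𝕂[[t]]`. -/
def ThetaPS (r : ℕ) (θ : 𝕂) (A : ℕ → 𝕂) : Matrix (Fin r) (Fin r) (PowerSeries 𝕂) :=
  Matrix.of fun i j =>
    if (i : ℕ) + 1 < r then (if (j : ℕ) = (i : ℕ) + 1 then 1 else 0)
    else if (j : ℕ) = 0 then (PowerSeries.X - PowerSeries.C θ) * PowerSeries.C (A r)⁻¹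
    else -(PowerSeries.C (A (j : ℕ)) * PowerSeries.C (A r)⁻¹)

/-- `h = φ_{t^{N−1}}(ξ) + φ_{t^{N−2}}(ξ) t + ⋯ + ξ t^{N−1}` viewed in `𝕂[[t]]`. -/
def hPS (q r N : ℕ) (θ : 𝕂) (A : ℕ → 𝕂) (ξ : 𝕂) : PowerSeries 𝕂 :=
  ∑ mm ∈ Finset.range N, PowerSeries.C ((phiT 𝕂 q r θ A)^[N - 1 - mm] ξ) * PowerSeries.X ^ mm

/-- The matrix `B = (h_j^{(i−1)})`. -/
def BPS (q r N : ℕ) (θ : 𝕂) (A : ℕ → 𝕂) (ξ : Fin r → 𝕂) :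
    Matrix (Fin r) (Fin r) (PowerSeries 𝕂) :=
  Matrix.of fun i j => twist 𝕂 q (i : ℕ) (hPS 𝕂 q r N θ A (ξ j))

/-- Partial products `F F^{(1)} ⋯ F^{(n)}` (successive factors multiplied on the right). -/
def prodTwists {r : ℕ} (q : ℕ) (F : Matrix (Fin r) (Fin r) (PowerSeries 𝕂)) (n : ℕ) :
    Matrix (Fin r) (Fin r) (PowerSeries 𝕂) :=
  ((List.range (n + 1)).map fun k => twistM 𝕂 q k F).prod

/-- Convergence of a sequence of matrices with respect to the Gauss norm. -/
def MTendsto {r : ℕ} (g : ℕ → Matrix (Fin r) (Fin r) (PowerSeries 𝕂))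
    (P : Matrix (Fin r) (Fin r) (PowerSeries 𝕂)) : Prop :=
  Tendsto (fun n => mnorm 𝕂 (g n - P)) atTop (nhds 0)

/-- Shadowed partitions: `(S_1, …, S_r) ∈ P_r(n)` iff `S_i ⊆ {0, …, n−1}` and the translates
`S_i + j`, `0 ≤ j ≤ i−1`, partition `{0, …, n−1}` (here `S i` is the paper's `S_{i+1}`). -/
def IsShadow (r n : ℕ) (S : Fin r → Finset ℕ) : Prop :=
  (∀ i, S i ⊆ Finset.range n) ∧
    ∀ x ∈ Finset.range n, ∃! p : Fin r × ℕ, p.2 ≤ (p.1 : ℕ) ∧ ∃ y ∈ S p.1, x = y + p.2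

open Classical in
/-- The (finite) set `P_r(n)` of shadowed partitions. -/
def shadowFinset (r n : ℕ) : Finset (Fin r → Finset ℕ) :=
  (Fintype.piFinset fun _ : Fin r => (Finset.range n).powerset).filter (IsShadow r n)

/-- `𝓑_n(t)` as an element of `𝕂[[t]]` (expanded on the unit disk). -/
def BnPS (q r : ℕ) (θ : 𝕂) (A : ℕ → 𝕂) (n : ℕ) : PowerSeries 𝕂 :=
  ∑ S ∈ shadowFinset r n, ∏ i : Fin r, ∏ j ∈ S i,
    PowerSeries.C (A ((i : ℕ) + 1) ^ q ^ j) *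
      (PowerSeries.X - PowerSeries.C (θ ^ q ^ ((i : ℕ) + 1 + j)))⁻¹

/-- Partial sums of `ℒ_φ(ξ;t) = Σ_n 𝓑_n(t) ξ^{q^n}`. -/
def LPartial (q r : ℕ) (θ : 𝕂) (A : ℕ → 𝕂) (ξ : 𝕂) (n : ℕ) : PowerSeries 𝕂 :=
  ∑ k ∈ Finset.range (n + 1), BnPS 𝕂 q r θ A k * PowerSeries.C (ξ ^ q ^ k)

/-- The exponential function `exp_φ(z) = Σ α_n z^{q^n}`. -/
def expF (q : ℕ) (α : ℕ → 𝕂) (z : 𝕂) : 𝕂 := ∑' n : ℕ, α n * z ^ q ^ n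

/-- Anderson generating function `f_φ(u;t) = Σ_m exp_φ(u/θ^{m+1}) t^m`. -/
def AGF (q : ℕ) (α : ℕ → 𝕂) (θ u : 𝕂) : PowerSeries 𝕂 :=
  PowerSeries.mk fun mm => expF 𝕂 q α (u / θ ^ (mm + 1))

/-- The subring `A = 𝔽_q[θ]` of `𝕂`. -/
def Asubring (q : ℕ) (θ : 𝕂) : Subring 𝕂 :=
  Subring.closure ({θ} ∪ {c : 𝕂 | c ^ q = c})

/-- `π_1, …, π_r` is an `A`-basis of the period lattice `Λ_φ = ker exp_φ`. -/
def IsPeriodBasis (q r : ℕ) (α : ℕ → 𝕂) (θ : 𝕂) (π : Fin r → 𝕂) : Prop :=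
  (∀ j, expF 𝕂 q α (π j) = 0) ∧
    ∀ z, expF 𝕂 q α z = 0 →
      ∃! a : Fin r → 𝕂, (∀ j, a j ∈ Asubring 𝕂 q θ) ∧ z = ∑ j, a j * π j

/-- Frobenius twist on `𝕂(t)`, induced by a Frobenius endomorphism of `𝕂`. -/
def twistRF (frobq : 𝕂 →+* 𝕂) : RatFunc 𝕂 →+* RatFunc 𝕂 :=
  RatFunc.mapRingHom (Polynomial.mapRingHom frobq) (by
    intro pp hpp
    simp only [Submonoid.mem_comap, Polynomial.coe_mapRingHom]
    rw [mem_nonZeroDivisors_iff_ne_zero] at hpp ⊢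
    exact (Polynomial.map_ne_zero_iff frobq.injective).mpr hpp)

/-- Entrywise `n`-fold Frobenius twist of a matrix over `𝕂(t)`. -/
def twistMRF {r : ℕ} (frobq : 𝕂 →+* 𝕂) (n : ℕ)
    (M : Matrix (Fin r) (Fin r) (RatFunc 𝕂)) : Matrix (Fin r) (Fin r) (RatFunc 𝕂) :=
  Matrix.of fun i j => (fun g => twistRF 𝕂 frobq g)^[n] (M i j)

/-- The matrix `Θ`, with entries viewed in `𝕂(t)`. -/
def ThetaRF (r : ℕ) (θ : 𝕂) (A : ℕ → 𝕂) : Matrix (Fin r) (Fin r) (RatFunc 𝕂) :=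
  Matrix.of fun i j =>
    if (i : ℕ) + 1 < r then (if (j : ℕ) = (i : ℕ) + 1 then 1 else 0)
    else if (j : ℕ) = 0 then (RatFunc.X - RatFunc.C θ) / RatFunc.C (A r)
    else -(RatFunc.C (A (j : ℕ)) / RatFunc.C (A r))

/-- `h` as an element of `𝕂(t)`. -/
def hRF (q r N : ℕ) (θ : 𝕂) (A : ℕ → 𝕂) (ξ : 𝕂) : RatFunc 𝕂 :=
  ∑ mm ∈ Finset.range N, RatFunc.C ((phiT 𝕂 q r θ A)^[N - 1 - mm] ξ) * RatFunc.X ^ mm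

/-- The matrix `B = (h_j^{(i−1)})` over `𝕂(t)`. -/
def BRF (q r N : ℕ) (frobq : 𝕂 →+* 𝕂) (θ : 𝕂) (A : ℕ → 𝕂) (ξ : Fin r → 𝕂) :
    Matrix (Fin r) (Fin r) (RatFunc 𝕂) :=
  Matrix.of fun i j => (fun g => twistRF 𝕂 frobq g)^[(i : ℕ)] (hRF 𝕂 q r N θ A (ξ j))

/-- The matrix `W` with first row `(ξ_1, …, ξ_r)` and all other entries `0`. -/
def WRF (r : ℕ) (ξ : Fin r → 𝕂) : Matrix (Fin r) (Fin r) (RatFunc 𝕂) :=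
  Matrix.of fun i j => if (i : ℕ) = 0 then RatFunc.C (ξ j) else 0

/-- `R_0 = I/(t−θ)` and `R_m = Θ^{−1}(Θ^{−1})^{(1)} ⋯ (Θ^{−1})^{(m−1)}/(t−θ^{q^m})`. -/
def RmRF (r : ℕ) (frobq : 𝕂 →+* 𝕂) (q : ℕ) (θ : 𝕂) (A : ℕ → 𝕂) (mm : ℕ) :
    Matrix (Fin r) (Fin r) (RatFunc 𝕂) :=
  (RatFunc.X - RatFunc.C (θ ^ q ^ mm))⁻¹ •
    ((List.range mm).map fun k => twistMRF 𝕂 frobq k (ThetaRF 𝕂 r θ A)⁻¹).prod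

/-- `𝓑_n(t)` as an element of `𝕂(t)`. -/
def BnRF (q r : ℕ) (θ : 𝕂) (A : ℕ → 𝕂) (n : ℕ) : RatFunc 𝕂 :=
  ∑ S ∈ shadowFinset r n, ∏ i : Fin r, ∏ j ∈ S i,
    RatFunc.C (A ((i : ℕ) + 1) ^ q ^ j) / (RatFunc.X - RatFunc.C (θ ^ q ^ ((i : ℕ) + 1 + j)))

/-- `𝓑_n(t)` for integer `n`, with `𝓑_n = 0` for `n < 0`. -/
def BnRFZ (q r : ℕ) (θ : 𝕂) (A : ℕ → 𝕂) (n : ℤ) : RatFunc 𝕂 :=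
  if n < 0 then 0 else BnRF 𝕂 q r θ A n.toNat

/-- `F = B^{−1} Θ^{−1} B^{(1)}` over `𝕂(t)`. -/
def FRF (q r N : ℕ) (frobq : 𝕂 →+* 𝕂) (θ : 𝕂) (A : ℕ → 𝕂) (ξ : Fin r → 𝕂) :
    Matrix (Fin r) (Fin r) (RatFunc 𝕂) :=
  (BRF 𝕂 q r N frobq θ A ξ)⁻¹ * (ThetaRF 𝕂 r θ A)⁻¹ *
    twistMRF 𝕂 frobq 1 (BRF 𝕂 q r N frobq θ A ξ)

/-- `Π_n = B F F^{(1)} ⋯ F^{(n)}` over `𝕂(t)`. -/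
def PiNRF (q r N : ℕ) (frobq : 𝕂 →+* 𝕂) (θ : 𝕂) (A : ℕ → 𝕂) (ξ : Fin r → 𝕂) (n : ℕ) :
    Matrix (Fin r) (Fin r) (RatFunc 𝕂) :=
  BRF 𝕂 q r N frobq θ A ξ *
    ((List.range (n + 1)).map fun k => twistMRF 𝕂 frobq k (FRF 𝕂 q r N frobq θ A ξ)).prod

lemma msum_lt {𝕂 : Type} [NontriviallyNormedField 𝕂]
    (hna : ∀ x y : 𝕂, ‖x + y‖ ≤ max ‖x‖ ‖y‖) (B : ℝ) (hB : 0 < B) (s : Multiset 𝕂)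
    (h : ∀ z ∈ s, ‖z‖ < B) : ‖s.sum‖ < B := by
  induction s using Multiset.induction with
  | empty => simpa using hB
  | cons a s ih =>
    rw [Multiset.sum_cons]
    exact lt_of_le_of_lt (hna _ _) (max_lt (h a (by simp)) (ih fun z hz => h z (by simp [hz])))

lemma fsum_lt {𝕂 : Type} [NontriviallyNormedField 𝕂]
    (hna : ∀ x y : 𝕂, ‖x + y‖ ≤ max ‖x‖ ‖y‖) (B : ℝ) (hB : 0 < B) (s : Finset ℕ) (f : ℕ → 𝕂)
    (h : ∀ i ∈ s, ‖f i‖ < B) : ‖∑ i ∈ s, f i‖ < B := by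
  apply msum_lt hna B hB
  intro z hz
  obtain ⟨i, hi, rfl⟩ := Multiset.mem_map.1 hz
  exact h i hi

open Polynomial in
lemma exists_small {𝕂 : Type} [NontriviallyNormedField 𝕂] [IsAlgClosed 𝕂]
    (hna : ∀ x y : 𝕂, ‖x + y‖ ≤ max ‖x‖ ‖y‖)
    (q : ℕ) (hq : 0 < q) (hq0 : (q : 𝕂) = 0)
    (θ : 𝕂) (hθ : ‖θ‖ = (q : ℝ)) (r : ℕ) (A : ℕ → 𝕂) (y : 𝕂) (hy : y ≠ 0) :
    ∃ x, phiT 𝕂 q r θ A x = y ∧ ‖x‖ * q ≤ ‖y‖ := by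
  have hqR : (0 : ℝ) < q := by exact_mod_cast hq
  have hyn : 0 < ‖y‖ := norm_pos_iff.2 hy
  let P : 𝕂[X] := C θ * X + ∑ i ∈ Finset.Icc 1 r, C (A i) * X ^ q ^ i - C y
  have hev : ∀ x, P.eval x = phiT 𝕂 q r θ A x - y := by
    intro x
    simp [P, phiT, eval_finset_sum]
  have hder : derivative P = C θ := by
    have : ∀ i ∈ Finset.Icc 1 r, derivative (C (A i) * X ^ q ^ i) = 0 := by
      intro i hi
      have hi1 : i ≠ 0 := by have := (Finset.mem_Icc.1 hi).1; omega
      simp [derivative_X_pow, hq0, hi1]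
    simp only [P, derivative_sub, derivative_add, derivative_sum, Finset.sum_congr rfl this]
    simp
  have hP0 : P.eval 0 = -y := by
    rw [hev]
    have : phiT 𝕂 q r θ A 0 = 0 := by
      simp [phiT]
      apply Finset.sum_eq_zero
      intro i _
      rw [zero_pow (pow_pos hq i).ne']; simp
    rw [this]; ring
  have hPne : P ≠ 0 := by
    intro h
    rw [h] at hP0; simp at hP0; exact hy hP0
  have key := (IsAlgClosed.splits P).eval_derivative_div_eval_of_ne_zero (x := 0) (by rw [hP0]; simpa using hy)
  rw [hder, hP0] at key
  by_contra hcon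
  push Not at hcon
  have hlt := msum_lt hna (q / ‖y‖) (by positivity) (P.roots.map fun z => 1 / (0 - z)) (by
    intro w hw
    obtain ⟨z, hz, rfl⟩ := Multiset.mem_map.1 hw
    have hz0 : P.eval z = 0 := (mem_roots'.1 hz).2
    have hz' := hcon z (by rw [hev] at hz0; exact sub_eq_zero.1 hz0)
    have hzn : 0 < ‖z‖ := by
      by_contra h
      have : ‖z‖ = 0 := le_antisymm (not_lt.1 h) (norm_nonneg _)
      rw [this] at hz'; linarith
    simp only [zero_sub, norm_div, norm_neg, norm_one]
    rw [div_lt_div_iff₀ hzn hyn]; linarith)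
  rw [← key] at hlt
  simp [hθ] at hlt

lemma phiT_sub {𝕂 : Type} [NontriviallyNormedField 𝕂]
    (p e q : ℕ) (hp : p.Prime) (hcharp : CharP 𝕂 p) (hqpe : q = p ^ e)
    (θ : 𝕂) (r : ℕ) (A : ℕ → 𝕂) (x y : 𝕂) :
    phiT 𝕂 q r θ A (x - y) = phiT 𝕂 q r θ A x - phiT 𝕂 q r θ A y := by
  have := Fact.mk hp
  have : ∀ i, (x - y) ^ q ^ i = x ^ q ^ i - y ^ q ^ i := by
    intro i
    rw [hqpe, ← pow_mul]
    exact sub_pow_char_pow ..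
  simp only [phiT, this, mul_sub, Finset.sum_sub_distrib]
  ring

lemma norm_phiT {𝕂 : Type} [NontriviallyNormedField 𝕂]
    (hna : ∀ x y : 𝕂, ‖x + y‖ ≤ max ‖x‖ ‖y‖)
    (q : ℕ) (hq : 1 < q) (θ : 𝕂) (hθ : ‖θ‖ = (q : ℝ)) (r : ℕ) (A : ℕ → 𝕂)
    (m : ℕ) (hm : IsMuIndex 𝕂 q r A m) (x : 𝕂) (hx : x ≠ 0)
    (hxR : ‖x‖ * q < Rphi 𝕂 q A m) : ‖phiT 𝕂 q r θ A x‖ = q * ‖x‖ := by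
  have hqR : (1 : ℝ) < q := by exact_mod_cast hq
  have hxn : 0 < ‖x‖ := norm_pos_iff.2 hx
  have : IsUltrametricDist 𝕂 :=
    IsUltrametricDist.isUltrametricDist_of_forall_norm_add_le_max_norm hna
  have hlt : ‖∑ i ∈ Finset.Icc 1 r, A i * x ^ q ^ i‖ < ‖θ * x‖ := by
    apply fsum_lt hna
    · rw [norm_mul, hθ]; positivity
    intro i hi
    obtain ⟨hi1, hir⟩ := Finset.mem_Icc.1 hi
    by_cases hA : A i = 0
    · rw [hA, zero_mul, norm_zero, norm_mul, hθ]; positivity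
    have hAn : 0 < ‖A i‖ := norm_pos_iff.2 hA
    have hmu := hm.2.1 i ⟨hi1, hir, hA⟩
    have hqi : (1 : ℝ) < (q : ℝ) ^ i := one_lt_pow₀ hqR (by omega)
    have h1 : Real.logb q (‖x‖ * q) < -muPhi 𝕂 q A m := by
      rw [Real.logb_lt_iff_lt_rpow hqR (by positivity)]
      exact hxR
    rw [Real.logb_mul hxn.ne' (by positivity), Real.logb_self_eq_one hqR] at h1
    have h2 : muPhi 𝕂 q A i < -(Real.logb q ‖x‖ + 1) := by linarith
    rw [muPhi, div_lt_iff₀ (by linarith), degK] at h2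
    rw [← Real.logb_lt_logb_iff hqR (by rw [norm_mul, norm_pow]; positivity) (by rw [norm_mul, hθ]; positivity)]
    rw [norm_mul, norm_mul, norm_pow, hθ, Real.logb_mul hAn.ne' (by positivity),
      Real.logb_mul (by positivity) hxn.ne', Real.logb_self_eq_one hqR, Real.logb_pow]
    push_cast
    nlinarith
  rw [phiT, IsUltrametricDist.norm_add_eq_max_of_norm_ne_norm hlt.ne', max_eq_left hlt.le, norm_mul, hθ]

theorem stmt9
    (𝕂 : Type) [NontriviallyNormedField 𝕂] [CompleteSpace 𝕂] [IsAlgClosed 𝕂]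
    (hna : ∀ x y : 𝕂, ‖x + y‖ ≤ max ‖x‖ ‖y‖)
    (p e q : ℕ) (hp : p.Prime) (hcharp : CharP 𝕂 p) (he : 0 < e) (hqpe : q = p ^ e)
    (θ : 𝕂) (hθ : ‖θ‖ = (q : ℝ))
    (r : ℕ) (hr : 0 < r) (A : ℕ → 𝕂) (hAr : A r ≠ 0)
    (m : ℕ) (hm : IsMuIndex 𝕂 q r A m)
    (y1 : 𝕂) (hy1 : phiT 𝕂 q r θ A y1 = 0) (hy1ne : y1 ≠ 0) :
    ∃ y : ℕ → 𝕂, y 0 = y1 ∧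
      (∀ k, phiT 𝕂 q r θ A (y (k + 1)) = y k) ∧
      (∀ k, degK 𝕂 q (y (k + 1)) ≤ degK 𝕂 q (y k) - 1) ∧
      (∃ N : ℕ, ‖y N‖ < Rphi 𝕂 q A m) ∧
      Tendsto (fun k => degK 𝕂 q (y k)) atTop atBot ∧
      ∃ N : ℕ, ‖y N‖ < Rphi 𝕂 q A m ∧
        ∀ k, N ≤ k → degK 𝕂 q (y (k + 1)) = degK 𝕂 q (y k) - 1 ∧
          ∀ z : 𝕂, phiT 𝕂 q r θ A z = y k → z ≠ y (k + 1) →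
            degK 𝕂 q (y k) - 1 < degK 𝕂 q z := by
  classical
  have hq : 1 < q := by
    rw [hqpe]; exact Nat.one_lt_pow he.ne' hp.one_lt
  have hqR : (1 : ℝ) < q := by exact_mod_cast hq
  have hq0 : (q : 𝕂) = 0 := by
    rw [hqpe]; push_cast; rw [CharP.cast_eq_zero]; exact zero_pow he.ne'
  have hz0 : phiT 𝕂 q r θ A 0 = 0 := by
    have := phiT_sub p e q hp hcharp hqpe θ r A 0 0
    simpa using this
  choose! f hf1 hf2 using exists_small hna q (by omega) hq0 θ hθ r A
  let y : ℕ → 𝕂 := fun k => f^[k] y1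
  have hys : ∀ k, y (k + 1) = f (y k) := fun k => Function.iterate_succ_apply' f k y1
  have hne : ∀ k, y k ≠ 0 := by
    intro k
    induction k with
    | zero => exact hy1ne
    | succ k ih =>
      intro h
      have := hf1 (y k) ih
      rw [← hys, h, hz0] at this
      exact ih this.symm
  have hphi : ∀ k, phiT 𝕂 q r θ A (y (k + 1)) = y k := fun k => by rw [hys]; exact hf1 _ (hne k)
  have hnorm : ∀ k, ‖y (k + 1)‖ * q ≤ ‖y k‖ := fun k => by rw [hys]; exact hf2 _ (hne k)
  have hpos : ∀ k, 0 < ‖y k‖ := fun k => norm_pos_iff.2 (hne k)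
  have hlog : ∀ x : 𝕂, x ≠ 0 → Real.logb q (‖x‖ * q) = degK 𝕂 q x + 1 := by
    intro x hx
    rw [Real.logb_mul (norm_ne_zero_iff.2 hx) (by positivity), Real.logb_self_eq_one hqR, degK]
  have hdeg : ∀ k, degK 𝕂 q (y (k + 1)) ≤ degK 𝕂 q (y k) - 1 := by
    intro k
    have := Real.logb_le_logb_of_le hqR (mul_pos (hpos (k + 1)) (by positivity)) (hnorm k)
    rw [hlog _ (hne _)] at this
    rw [degK] at this ⊢
    rw [degK]
    linarith
  have hlin : ∀ k : ℕ, degK 𝕂 q (y k) ≤ degK 𝕂 q (y 0) - k := by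
    intro k
    induction k with
    | zero => simp
    | succ k ih => have := hdeg k; push_cast; linarith
  have htend : Tendsto (fun k => degK 𝕂 q (y k)) atTop atBot := by
    apply tendsto_atBot_mono hlin
    exact tendsto_atBot_add_const_left _ _ (tendsto_neg_atTop_atBot.comp tendsto_natCast_atTop_atTop)
  have hN : ∃ N : ℕ, ‖y N‖ < Rphi 𝕂 q A m := by
    obtain ⟨N, hN⟩ := (htend.eventually (eventually_lt_atBot (-(muPhi 𝕂 q A m)))).exists
    exact ⟨N, (Real.logb_lt_iff_lt_rpow hqR (hpos N)).1 hN⟩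
  refine ⟨y, rfl, hphi, hdeg, hN, htend, ?_⟩
  obtain ⟨N, hN⟩ := hN
  refine ⟨N, hN, ?_⟩
  intro k hk
  have hkR : ‖y k‖ < Rphi 𝕂 q A m := by
    induction k, hk using Nat.le_induction with
    | base => exact hN
    | succ k hk ih =>
      have h1 := hnorm k
      have h2 := hpos (k + 1)
      nlinarith
  have hk1 : ‖y (k + 1)‖ * q < Rphi 𝕂 q A m := lt_of_le_of_lt (hnorm k) hkR
  have heq := norm_phiT hna q hq θ hθ r A m hm (y (k + 1)) (hne _) hk1
  rw [hphi] at heq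
  have hd : degK 𝕂 q (y k) = degK 𝕂 q (y (k + 1)) + 1 := by
    rw [← hlog _ (hne _), mul_comm, ← heq, degK]
  refine ⟨by linarith, ?_⟩
  intro z hz hzne
  by_contra hcon
  push Not at hcon
  have hzn : z ≠ 0 := by
    rintro rfl
    rw [hz0] at hz
    exact hne k hz.symm
  have hzle : ‖z‖ ≤ ‖y (k + 1)‖ := by
    have : degK 𝕂 q z ≤ degK 𝕂 q (y (k + 1)) := by linarith
    exact (Real.logb_le_logb hqR (norm_pos_iff.2 hzn) (hpos _)).1 this
  have hw : z - y (k + 1) ≠ 0 := sub_ne_zero.2 hzne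
  have hwle : ‖z - y (k + 1)‖ ≤ ‖y (k + 1)‖ := by
    rw [sub_eq_add_neg]
    refine (hna _ _).trans ?_
    rw [norm_neg]
    exact max_le hzle le_rfl
  have hweq := norm_phiT hna q hq θ hθ r A m hm _ hw
    (lt_of_le_of_lt (mul_le_mul_of_nonneg_right hwle (by positivity)) hk1)
  rw [phiT_sub p e q hp hcharp hqpe, hz, hphi, sub_self, norm_zero] at hweq
  have := norm_pos_iff.2 hw
  have : 0 < (q : ℝ) * ‖z - y (k + 1)‖ := by positivity
  linarith


end DrinfeldRAT
end
end

section
/- Let φ be a Drinfeld module of rank r over 𝕂 and let x_1, …, x_r be any 𝔽_q-basis of φ[t]. Then there exist N ≥ 1 and ξ_1, …, ξ_r ∈ φ[t^N] such that for each j = 1, …, r: (1) |ξ_j| < R_φ; (2) φ_{t^{N−1}}(ξ_j) = x_j; and (3) deg φ_{t^{N−1}}(ξ_j) > deg φ_{t^{N−2}}(ξ_j) > ⋯ > deg φ_t(ξ_j) > deg ξ_j. -/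
open Filter

set_option maxHeartbeats 1000000
set_option synthInstance.maxHeartbeats 400000

noncomputable section

namespace DrinfeldRAT

variable (𝕂 : Type) [NontriviallyNormedField 𝕂]

theorem aux_prod (𝕂 : Type) [NontriviallyNormedField 𝕂]
    (hna : ∀ x y : 𝕂, ‖x + y‖ ≤ max ‖x‖ ‖y‖) (ρ : ℝ) (hρ : 0 ≤ ρ) (s : Multiset 𝕂)
    (hs : ∀ a ∈ s, ρ ≤ ‖a‖) :
    ρ * ‖(s.map fun a => Polynomial.X - Polynomial.C a).prod.coeff 1‖ ≤
      ‖(s.map fun a => Polynomial.X - Polynomial.C a).prod.coeff 0‖ := by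
  induction s using Multiset.induction_on with
  | empty => simp [Polynomial.coeff_one]
  | cons a s ih =>
    have ih' := ih (fun b hb => hs b (Multiset.mem_cons_of_mem hb))
    have ha := hs a (Multiset.mem_cons_self a s)
    rw [Multiset.map_cons, Multiset.prod_cons]
    generalize (s.map fun a => Polynomial.X - Polynomial.C a).prod = Q at ih' ⊢
    have h0 : ((Polynomial.X - Polynomial.C a) * Q).coeff 0 = -(a * Q.coeff 0) := by
      simp [sub_mul]
    have h1 : ((Polynomial.X - Polynomial.C a) * Q).coeff 1 = Q.coeff 0 + -(a * Q.coeff 1) := by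
      rw [sub_mul, Polynomial.coeff_sub, Polynomial.coeff_C_mul, Polynomial.coeff_X_mul, sub_eq_add_neg]
    rw [h0, h1, norm_neg, norm_mul]
    have h2 := hna (Q.coeff 0) (-(a * Q.coeff 1))
    rw [norm_neg, norm_mul] at h2
    have h3 : ρ * ‖Q.coeff 0‖ ≤ ‖a‖ * ‖Q.coeff 0‖ := by gcongr
    have h4 : ‖a‖ * (ρ * ‖Q.coeff 1‖) ≤ ‖a‖ * ‖Q.coeff 0‖ := by gcongr
    rcases le_max_iff.1 h2 with h | h
    · exact (mul_le_mul_of_nonneg_left h hρ).trans h3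
    · refine (mul_le_mul_of_nonneg_left h hρ).trans ?_
      linarith

theorem aux_step (𝕂 : Type) [NontriviallyNormedField 𝕂] [IsAlgClosed 𝕂]
    (hna : ∀ x y : 𝕂, ‖x + y‖ ≤ max ‖x‖ ‖y‖) (q : ℕ) (hq : 2 ≤ q)
    (θ : 𝕂) (hθ : ‖θ‖ = (q : ℝ))
    (r : ℕ) (hr : 0 < r) (A : ℕ → 𝕂) (hAr : A r ≠ 0) (x : 𝕂) :
    ∃ y, phiT 𝕂 q r θ A y = x ∧ q * ‖y‖ ≤ ‖x‖ := by
  classical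
  have hpow : ∀ i, 1 ≤ i → 1 < q ^ i := fun i hi => Nat.one_lt_pow (by omega) (by omega)
  set P : Polynomial 𝕂 := Polynomial.C θ * Polynomial.X +
    ∑ i ∈ Finset.Icc 1 r, Polynomial.C (A i) * Polynomial.X ^ q ^ i - Polynomial.C x with hP
  have hev : ∀ y, P.eval y = phiT 𝕂 q r θ A y - x := by
    intro y
    simp [hP, phiT, Polynomial.eval_finsetSum]
  have c0 : P.coeff 0 = -x := by
    rw [Polynomial.coeff_zero_eq_eval_zero, hev]
    simp only [phiT]
    rw [Finset.sum_eq_zero]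
    · simp
    · intro i hi
      rw [zero_pow, mul_zero]
      have := hpow i (Finset.mem_Icc.1 hi).1
      omega
  have c1 : P.coeff 1 = θ := by
    simp only [hP, Polynomial.coeff_sub, Polynomial.coeff_add, Polynomial.finsetSum_coeff,
      Polynomial.coeff_C_mul, Polynomial.coeff_X_pow, Polynomial.coeff_X_one]
    rw [Finset.sum_eq_zero]
    · simp [Polynomial.coeff_C]
    · intro i hi
      rw [if_neg, mul_zero]
      have := hpow i (Finset.mem_Icc.1 hi).1
      omega
  have hθ0 : θ ≠ 0 := by
    rw [← norm_pos_iff, hθ]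
    exact_mod_cast (by omega : 0 < q)
  have hcr : P.coeff (q ^ r) = A r := by
    have h1 := hpow r hr
    simp only [hP, Polynomial.coeff_sub, Polynomial.coeff_add, Polynomial.finsetSum_coeff,
      Polynomial.coeff_C_mul, Polynomial.coeff_X_pow, Polynomial.coeff_X, Polynomial.coeff_C]
    rw [if_neg (by omega), if_neg (by omega), Finset.sum_eq_single r]
    · simp
    · intro i hi hir
      rw [if_neg, mul_zero]
      intro h
      exact hir (Nat.pow_right_injective hq h).symm
    · intro h
      exact absurd (Finset.mem_Icc.2 ⟨hr, le_rfl⟩) h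
  have hP0 : P ≠ 0 := fun h => hθ0 (by rw [← c1, h, Polynomial.coeff_zero])
  have hdeg : P.degree ≠ 0 := by
    have h1 : ((q ^ r : ℕ) : WithBot ℕ) ≤ P.degree :=
      Polynomial.le_degree_of_ne_zero (by rw [hcr]; exact hAr)
    intro h
    rw [h] at h1
    have h2 := hpow r hr
    have h3 : q ^ r ≤ 0 := by exact_mod_cast h1
    omega
  obtain ⟨y0, hy0⟩ := IsAlgClosed.exists_root P hdeg
  have hne : P.roots.toFinset.Nonempty := ⟨y0, Multiset.mem_toFinset.2 ((Polynomial.mem_roots hP0).2 hy0)⟩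
  obtain ⟨y, hy, hmin⟩ := Finset.exists_min_image P.roots.toFinset (fun a => ‖a‖) hne
  refine ⟨y, ?_, ?_⟩
  · have : P.IsRoot y := (Polynomial.mem_roots hP0).1 (Multiset.mem_toFinset.1 hy)
    rw [Polynomial.IsRoot, hev, sub_eq_zero] at this
    exact this
  · have h := aux_prod 𝕂 hna ‖y‖ (norm_nonneg y) P.roots
      (fun a ha => hmin a (Multiset.mem_toFinset.2 ha))
    have hs := (IsAlgClosed.splits P).eq_prod_roots
    have e0 : ‖x‖ = ‖P.leadingCoeff‖ *
        ‖(P.roots.map fun a => Polynomial.X - Polynomial.C a).prod.coeff 0‖ := by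
      rw [← norm_mul, ← Polynomial.coeff_C_mul, ← hs, c0, norm_neg]
    have e1 : (q : ℝ) = ‖P.leadingCoeff‖ *
        ‖(P.roots.map fun a => Polynomial.X - Polynomial.C a).prod.coeff 1‖ := by
      rw [← norm_mul, ← Polynomial.coeff_C_mul, ← hs, c1, hθ]
    rw [e0, e1]
    have := mul_le_mul_of_nonneg_left h (norm_nonneg P.leadingCoeff)
    linarith

theorem stmt10
    (𝕂 : Type) [NontriviallyNormedField 𝕂] [CompleteSpace 𝕂] [IsAlgClosed 𝕂]
    (hna : ∀ x y : 𝕂, ‖x + y‖ ≤ max ‖x‖ ‖y‖)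
    (p e q : ℕ) (hp : p.Prime) (hcharp : CharP 𝕂 p) (he : 0 < e) (hqpe : q = p ^ e)
    (θ : 𝕂) (hθ : ‖θ‖ = (q : ℝ))
    (r : ℕ) (hr : 0 < r) (A : ℕ → 𝕂) (hAr : A r ≠ 0)
    (m : ℕ) (hm : IsMuIndex 𝕂 q r A m)
    (x : Fin r → 𝕂) (hxb : IsFqBasis 𝕂 q r θ A x) :
    ∃ N : ℕ, 1 ≤ N ∧ ∃ ξ : Fin r → 𝕂, GoodXi 𝕂 q r N θ A m x ξ := by
  have hq : 2 ≤ q := by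
    rw [hqpe]
    exact hp.two_le.trans (Nat.le_self_pow (by omega) p)
  have hq1 : (1 : ℝ) < q := by exact_mod_cast (by omega : 1 < q)
  have hq0 : (0 : ℝ) < q := by linarith
  have hf0 : phiT 𝕂 q r θ A 0 = 0 := by
    simp only [phiT]
    rw [Finset.sum_eq_zero]
    · simp
    · intro i hi
      rw [zero_pow, mul_zero]
      exact pow_ne_zero _ (by omega)
  have hx0 : ∀ j, x j ≠ 0 := by
    intro j hj
    obtain ⟨c, -, hc⟩ := hxb.2 0 hf0
    have h0 := hc (fun _ => 0) ⟨fun _ => zero_pow (by omega), by simp⟩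
    have h1 := hc (Pi.single j 1) ⟨by
      intro i
      by_cases h : i = j
      · subst h; simp
      · simp [Pi.single_eq_of_ne h, zero_pow (show q ≠ 0 by omega)], by
      rw [Finset.sum_eq_single j]
      · simp [hj]
      · intro b _ hb
        simp [Pi.single_eq_of_ne hb]
      · simp⟩
    have := congrFun (h1.trans h0.symm) j
    simp at this
  choose g hg1 hg2 using aux_step 𝕂 hna q hq θ hθ r hr A hAr
  have hgn : ∀ n z, (q : ℝ) ^ n * ‖g^[n] z‖ ≤ ‖z‖ := by
    intro n
    induction n with
    | zero => intro z; simp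
    | succ n ih =>
      intro z
      rw [Function.iterate_succ_apply', pow_succ, mul_assoc]
      exact (mul_le_mul_of_nonneg_left (hg2 _) (by positivity)).trans (ih z)
  have hfg : ∀ n z, (phiT 𝕂 q r θ A)^[n] (g^[n] z) = z := fun n z =>
    Function.LeftInverse.iterate hg1 n z
  have hR : 0 < Rphi 𝕂 q A m := Real.rpow_pos_of_pos hq0 _
  obtain ⟨n, hn⟩ := pow_unbounded_of_one_lt ((∑ j, ‖x j‖) / Rphi 𝕂 q A m) hq1
  refine ⟨n + 1, by omega, fun j => g^[n] (x j), ?_⟩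
  intro j
  refine ⟨?_, ?_, ?_, ?_⟩
  · rw [Function.iterate_succ_apply', hfg, hxb.1 j]
  · have h1 := hgn n (x j)
    rw [div_lt_iff₀ hR] at hn
    have h2 : ‖x j‖ ≤ ∑ j, ‖x j‖ :=
      Finset.single_le_sum (f := fun j => ‖x j‖) (fun _ _ => norm_nonneg _) (Finset.mem_univ j)
    exact lt_of_mul_lt_mul_left ((h1.trans h2).trans_lt hn) (by positivity)
  · exact hfg n (x j)
  · intro i hi
    have hi' : i + 1 ≤ n := hi
    have key : ∀ i, i ≤ n → (phiT 𝕂 q r θ A)^[i] (g^[n] (x j)) = g^[n - i] (x j) := by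
      intro i hi
      obtain ⟨k, rfl⟩ := Nat.exists_eq_add_of_le hi
      rw [Function.iterate_add_apply, hfg]
      congr 2
      omega
    rw [key i (by omega), key (i + 1) hi', show n - i = (n - (i + 1)) + 1 by omega,
      Function.iterate_succ_apply']
    generalize n - (i + 1) = k
    have hw : g^[k] (x j) ≠ 0 := by
      intro h
      have h1 := hfg k (x j)
      rw [h, Function.iterate_fixed hf0] at h1
      exact hx0 j h1.symm
    generalize g^[k] (x j) = w at hw
    have hgw : g w ≠ 0 := by
      intro h
      have h1 := hg1 w
      rw [h, hf0] at h1
      exact hw h1.symm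
    have hp1 : 0 < ‖g w‖ := norm_pos_iff.2 hgw
    refine Real.logb_lt_logb hq1 hp1 ?_
    have := hg2 w
    nlinarith


end DrinfeldRAT
end
end

section
/- Let φ be a Drinfeld module of rank r over 𝕂, and for 1 ≤ j ≤ s let a_j denote the y-intercept of the line containing the j-th edge of the Newton polygon of φ_t(x), i.e., a_j = −deg A_{d_{j−1}} − λ_j q^{d_{j−1}}. Then: (1) a_1 = μ_m; (2) a_1 > a_2 > ⋯ > a_s; and (3) a_j ≤ (deg A_{d_j} − q^{d_j})/(q^{d_j} − 1) for every j = 1, …, s. -/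
open Filter

set_option maxHeartbeats 1000000
set_option synthInstance.maxHeartbeats 400000

noncomputable section

namespace DrinfeldRAT

variable (𝕂 : Type) [NontriviallyNormedField 𝕂]

theorem stmt11
    (𝕂 : Type) [NontriviallyNormedField 𝕂] [CompleteSpace 𝕂] [IsAlgClosed 𝕂]
    (hna : ∀ x y : 𝕂, ‖x + y‖ ≤ max ‖x‖ ‖y‖)
    (p e q : ℕ) (hp : p.Prime) (hcharp : CharP 𝕂 p) (he : 0 < e) (hqpe : q = p ^ e)
    (θ : 𝕂) (hθ : ‖θ‖ = (q : ℝ))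
    (r : ℕ) (hr : 0 < r) (A : ℕ → 𝕂) (hAr : A r ≠ 0)
    (ND : NewtonData 𝕂 q r θ A)
    (m : ℕ) (hm : IsMuIndex 𝕂 q r A m)
    :
    (-(degK 𝕂 q (Acoef 𝕂 θ A (ND.d 0))) - ND.lam 1 * (q : ℝ) ^ ND.d 0 = muPhi 𝕂 q A m) ∧
    (∀ j, 1 ≤ j → j + 1 ≤ ND.s →
      -(degK 𝕂 q (Acoef 𝕂 θ A (ND.d j))) - ND.lam (j + 1) * (q : ℝ) ^ ND.d j <
        -(degK 𝕂 q (Acoef 𝕂 θ A (ND.d (j - 1)))) - ND.lam j * (q : ℝ) ^ ND.d (j - 1)) ∧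
    (∀ j, 1 ≤ j → j ≤ ND.s →
      -(degK 𝕂 q (Acoef 𝕂 θ A (ND.d (j - 1)))) - ND.lam j * (q : ℝ) ^ ND.d (j - 1) ≤
        (degK 𝕂 q (A (ND.d j)) - (q : ℝ) ^ ND.d j) / ((q : ℝ) ^ ND.d j - 1)) := by
  obtain ⟨hmN, hmax, -⟩ := hm
  have hq2 : 2 ≤ q := by
    rw [hqpe]
    exact hp.two_le.trans (Nat.le_self_pow he.ne' p)
  have hq1 : (1 : ℝ) < q := by exact_mod_cast hq2
  have hpow : ∀ n : ℕ, 1 ≤ n → (1 : ℝ) < (q : ℝ) ^ n := fun n hn =>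
    one_lt_pow₀ hq1 (by omega)
  have hθ0 : θ ≠ 0 := by
    rw [← norm_pos_iff, hθ]; linarith
  have hdegθ : degK 𝕂 q θ = 1 := by
    unfold degK
    rw [hθ]
    exact Real.logb_self_eq_one hq1
  have hA0 : Acoef 𝕂 θ A 0 = θ := by simp [Acoef]
  have hAn : ∀ n, 1 ≤ n → Acoef 𝕂 θ A n = A n := fun n hn => by
    simp [Acoef, show n ≠ 0 by omega]
  have hdge : ∀ j, j ≤ ND.s → j ≤ ND.d j := by
    intro j
    induction j with
    | zero => intro _; exact Nat.zero_le _
    | succ k ih =>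
      intro h
      have h1 := ih (by omega)
      have h2 := ND.d_mono k (by omega)
      omega
  have hdle : ∀ k, k ≤ ND.s → ND.d (ND.s - k) ≤ r := by
    intro k
    induction k with
    | zero => intro _; simp [ND.d_last]
    | succ k ih =>
      intro h
      have h1 := ih (by omega)
      have h2 := ND.d_mono (ND.s - (k + 1)) (by omega)
      rw [show ND.s - (k + 1) + 1 = ND.s - k by omega] at h2
      omega
  have hdr : ∀ j, j ≤ ND.s → ND.d j ≤ r := by
    intro j hj
    have h := hdle (ND.s - j) (by omega)
    rwa [show ND.s - (ND.s - j) = j by omega] at h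
  -- both endpoints of an edge give the same intercept
  have hint : ∀ j, 1 ≤ j → j ≤ ND.s →
      -(degK 𝕂 q (Acoef 𝕂 θ A (ND.d (j - 1)))) - ND.lam j * (q : ℝ) ^ ND.d (j - 1) =
      -(degK 𝕂 q (Acoef 𝕂 θ A (ND.d j))) - ND.lam j * (q : ℝ) ^ ND.d j := by
    intro j h1 h2
    have hs := ND.slope_eq j h1 h2
    have hd := ND.d_mono (j - 1) (by omega)
    rw [show j - 1 + 1 = j by omega] at hd
    have hlt : (q : ℝ) ^ ND.d (j - 1) < (q : ℝ) ^ ND.d j := pow_lt_pow_right₀ hq1 hd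
    rw [eq_div_iff (by linarith)] at hs
    linarith
  have hs1 : 1 ≤ ND.s := ND.s_pos
  refine ⟨?_, ?_, ?_⟩
  · have hi := hint 1 le_rfl hs1
    have hd1 := hdge 1 hs1
    simp only [Nat.sub_self, ND.d_zero, hA0, hdegθ, pow_zero, mul_one, hAn _ hd1] at hi ⊢
    have hN1 : inNphi 𝕂 r A (ND.d 1) := ⟨hd1, hdr 1 hs1, ND.vertex_ne 1 le_rfl hs1⟩
    apply le_antisymm
    · refine le_trans (le_of_eq ?_) (hmax _ hN1)
      unfold muPhi
      have := hpow _ hd1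
      rw [eq_div_iff (by linarith)]
      linarith
    · obtain ⟨hm1, hmr, hmA⟩ := hmN
      have hh := ND.hull m hmr (by rwa [hAn m hm1]) 1 le_rfl hs1
      rw [hAn m hm1, hAn _ hd1] at hh
      unfold muPhi
      have := hpow m hm1
      rw [div_le_iff₀ (by linarith)]
      linarith
  · intro j h1 h2
    rw [hint j h1 (by omega)]
    have hl := ND.lam_mono j h1 h2
    have hQ : (0 : ℝ) < (q : ℝ) ^ ND.d j := by positivity
    have := mul_lt_mul_of_pos_right hl hQ
    linarith
  · intro j h1 h2
    have hd1 : 1 ≤ ND.d j := h1.trans (hdge j h2)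
    rw [hint j h1 h2]
    have hh := ND.hull 0 (Nat.zero_le _) (by rwa [hA0]) j h1 h2
    rw [hA0, hdegθ, pow_zero, hAn _ hd1] at hh
    rw [hAn _ hd1]
    have hQ := hpow _ hd1
    rw [le_div_iff₀ (by linarith)]
    have := mul_le_mul_of_nonneg_right hh (by linarith : (0 : ℝ) ≤ (q : ℝ) ^ ND.d j)
    nlinarith

end DrinfeldRAT
end
end

section
/- Let φ be a Drinfeld module of rank r over 𝕂. Then there exists a strict 𝔽_q-basis of φ[t]; that is, an 𝔽_q-basis x_1, …, x_r of φ[t] such that deg x_j = λ_k whenever d_{k−1} + 1 ≤ j ≤ d_k. -/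
open Filter

set_option maxHeartbeats 1000000
set_option synthInstance.maxHeartbeats 400000

noncomputable section

namespace DrinfeldRAT

variable (𝕂 : Type) [NontriviallyNormedField 𝕂]

open Polynomial

def Dom {K : Type} [NormedField K] (f : K[X]) (n : ℕ) (ρ : ℝ) : Prop :=
  f.coeff n ≠ 0 ∧ ∀ i, ‖f.coeff i‖ * ρ ^ i ≤ ‖f.coeff n‖ * ρ ^ n ∧
    (n < i → ‖f.coeff i‖ * ρ ^ i < ‖f.coeff n‖ * ρ ^ n)

lemma Dom.unique {K : Type} [NormedField K] {f : K[X]} {n m : ℕ} {ρ : ℝ}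
    (h1 : Dom f n ρ) (h2 : Dom f m ρ) : n = m := by
  rcases lt_trichotomy n m with h | h | h
  · exact absurd ((h1.2 m).2 h) (not_lt.mpr (h2.2 n).1)
  · exact h
  · exact absurd ((h2.2 n).2 h) (not_lt.mpr (h1.2 m).1)

lemma Dom.const_mul {K : Type} [NormedField K] {f : K[X]} {n : ℕ} {ρ : ℝ}
    (h1 : Dom f n ρ) (a : K) (ha : a ≠ 0) : Dom (C a * f) n ρ := by
  have ha' : 0 < ‖a‖ := norm_pos_iff.mpr ha
  refine ⟨by simpa [ha] using h1.1, fun i => ⟨?_, fun hi => ?_⟩⟩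
  · simp only [coeff_C_mul, norm_mul, mul_assoc]
    exact mul_le_mul_of_nonneg_left (h1.2 i).1 ha'.le
  · simp only [coeff_C_mul, norm_mul, mul_assoc]
    exact mul_lt_mul_of_pos_left ((h1.2 i).2 hi) ha'

lemma na_sub_le {K : Type} [NormedField K] (hna : ∀ x y : K, ‖x + y‖ ≤ max ‖x‖ ‖y‖) (x y : K) :
    ‖x - y‖ ≤ max ‖x‖ ‖y‖ := by
  have := hna x (-y)
  rwa [norm_neg, ← sub_eq_add_neg] at this

lemma na_sub_eq {K : Type} [NormedField K] (hna : ∀ x y : K, ‖x + y‖ ≤ max ‖x‖ ‖y‖) (x y : K)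
    (h : ‖y‖ < ‖x‖) : ‖x - y‖ = ‖x‖ := by
  apply le_antisymm
  · exact (na_sub_le hna x y).trans (by rw [max_eq_left h.le])
  · have := hna (x - y) y
    rw [sub_add_cancel] at this
    rcases le_max_iff.mp this with h1 | h1
    · exact h1
    · linarith

lemma na_sub_eq' {K : Type} [NormedField K] (hna : ∀ x y : K, ‖x + y‖ ≤ max ‖x‖ ‖y‖) (x y : K)
    (h : ‖x‖ < ‖y‖) : ‖x - y‖ = ‖y‖ := by
  rw [norm_sub_rev]; exact na_sub_eq hna y x h

lemma Dom.step_le {K : Type} [NormedField K] (hna : ∀ x y : K, ‖x + y‖ ≤ max ‖x‖ ‖y‖)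
    {f : K[X]} {n : ℕ} {ρ : ℝ} (hρ : 0 < ρ) (h : Dom f n ρ) (w : K) (hw : ‖w‖ ≤ ρ) :
    Dom ((X - C w) * f) (n + 1) ρ := by
  have c0 : ((X - C w) * f).coeff 0 = 0 - w * f.coeff 0 := by
    simp [sub_mul]
  have cs : ∀ i, ((X - C w) * f).coeff (i + 1) = f.coeff i - w * f.coeff (i + 1) := by
    intro i; simp [sub_mul]
  have hM : 0 < ‖f.coeff n‖ * ρ ^ n := mul_pos (norm_pos_iff.mpr h.1) (by positivity)
  have key : ∀ i, ‖w * f.coeff i‖ * ρ ^ i ≤ ρ * (‖f.coeff i‖ * ρ ^ i) := by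
    intro i
    rw [norm_mul, mul_assoc]
    exact mul_le_mul_of_nonneg_right hw (by positivity)
  have top : ‖((X - C w) * f).coeff (n + 1)‖ = ‖f.coeff n‖ := by
    rw [cs]
    apply na_sub_eq hna
    have h1 := key (n + 1)
    have h2 := (h.2 (n + 1)).2 (Nat.lt_succ_self n)
    have h3 : ‖w * f.coeff (n+1)‖ * ρ ^ (n+1) < ‖f.coeff n‖ * ρ ^ (n+1) := by
      calc _ ≤ _ := h1
        _ < ρ * (‖f.coeff n‖ * ρ ^ n) := mul_lt_mul_of_pos_left h2 hρ
        _ = _ := by ring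
    exact lt_of_mul_lt_mul_right h3 (by positivity)
  have topv : ‖((X - C w) * f).coeff (n + 1)‖ * ρ ^ (n+1) = ρ * (‖f.coeff n‖ * ρ ^ n) := by
    rw [top]; ring
  refine ⟨?_, fun i => ?_⟩
  · rw [← norm_pos_iff, top]; exact norm_pos_iff.mpr h.1
  rw [topv]
  rcases i with _ | i
  · refine ⟨?_, by simp⟩
    rw [c0, zero_sub, norm_neg]
    exact (key 0).trans (mul_le_mul_of_nonneg_left (h.2 0).1 hρ.le)
  · have b : ‖((X - C w) * f).coeff (i + 1)‖ * ρ ^ (i+1) ≤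
        max (ρ * (‖f.coeff i‖ * ρ ^ i)) (ρ * (‖f.coeff (i+1)‖ * ρ ^ (i+1))) := by
      rw [cs]
      have h1 : ‖f.coeff i - w * f.coeff (i+1)‖ * ρ ^ (i+1) ≤
          max ‖f.coeff i‖ ‖w * f.coeff (i+1)‖ * ρ ^ (i+1) :=
        mul_le_mul_of_nonneg_right (na_sub_le hna _ _) (by positivity)
      rw [max_mul_of_nonneg _ _ (by positivity)] at h1
      refine h1.trans (max_le_max (le_of_eq (by ring)) (key (i+1)))
    refine ⟨b.trans (max_le ?_ ?_), fun hi => b.trans_lt (max_lt ?_ ?_)⟩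
    · exact mul_le_mul_of_nonneg_left (h.2 i).1 hρ.le
    · exact mul_le_mul_of_nonneg_left (h.2 (i+1)).1 hρ.le
    · exact mul_lt_mul_of_pos_left ((h.2 i).2 (by omega)) hρ
    · exact mul_lt_mul_of_pos_left ((h.2 (i+1)).2 (by omega)) hρ

lemma Dom.step_gt {K : Type} [NormedField K] (hna : ∀ x y : K, ‖x + y‖ ≤ max ‖x‖ ‖y‖)
    {f : K[X]} {n : ℕ} {ρ : ℝ} (hρ : 0 < ρ) (h : Dom f n ρ) (w : K) (hw : ρ < ‖w‖) :
    Dom ((X - C w) * f) n ρ := by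
  have c0 : ((X - C w) * f).coeff 0 = 0 - w * f.coeff 0 := by
    simp [sub_mul]
  have cs : ∀ i, ((X - C w) * f).coeff (i + 1) = f.coeff i - w * f.coeff (i + 1) := by
    intro i; simp [sub_mul]
  have hM : 0 < ‖f.coeff n‖ * ρ ^ n := mul_pos (norm_pos_iff.mpr h.1) (by positivity)
  have hw0 : 0 < ‖w‖ := hρ.trans hw
  have key : ∀ i, ‖f.coeff i‖ * ρ ^ (i + 1) < ‖w‖ * (‖f.coeff n‖ * ρ ^ n) := by
    intro i
    calc ‖f.coeff i‖ * ρ ^ (i + 1) = ρ * (‖f.coeff i‖ * ρ ^ i) := by ring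
      _ ≤ ρ * (‖f.coeff n‖ * ρ ^ n) := mul_le_mul_of_nonneg_left (h.2 i).1 hρ.le
      _ < _ := mul_lt_mul_of_pos_right hw hM
  have top : ‖((X - C w) * f).coeff n‖ = ‖w‖ * ‖f.coeff n‖ := by
    rcases n with _ | n
    · rw [c0, zero_sub, norm_neg, norm_mul]
    · rw [cs, na_sub_eq' hna, norm_mul]
      rw [norm_mul]
      have := key n
      rw [← mul_assoc] at this
      exact lt_of_mul_lt_mul_right this (by positivity)
  have topv : ‖((X - C w) * f).coeff n‖ * ρ ^ n = ‖w‖ * (‖f.coeff n‖ * ρ ^ n) := by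
    rw [top]; ring
  refine ⟨?_, fun i => ?_⟩
  · rw [← norm_pos_iff, top]; exact mul_pos hw0 (norm_pos_iff.mpr h.1)
  rw [topv]
  rcases i with _ | i
  · refine ⟨?_, by simp⟩
    rw [c0, zero_sub, norm_neg, norm_mul, mul_assoc]
    exact (mul_le_mul_of_nonneg_left (h.2 0).1 hw0.le)
  · have b : ‖((X - C w) * f).coeff (i + 1)‖ * ρ ^ (i+1) ≤
        max (‖f.coeff i‖ * ρ ^ (i+1)) (‖w‖ * (‖f.coeff (i+1)‖ * ρ ^ (i+1))) := by
      rw [cs]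
      have h1 : ‖f.coeff i - w * f.coeff (i+1)‖ * ρ ^ (i+1) ≤
          max ‖f.coeff i‖ ‖w * f.coeff (i+1)‖ * ρ ^ (i+1) :=
        mul_le_mul_of_nonneg_right (na_sub_le hna _ _) (by positivity)
      rw [max_mul_of_nonneg _ _ (by positivity)] at h1
      refine h1.trans (max_le_max le_rfl (le_of_eq (by rw [norm_mul]; ring)))
    refine ⟨b.trans (max_le (key i).le ?_), fun hi => b.trans_lt (max_lt (key i) ?_)⟩
    · exact mul_le_mul_of_nonneg_left (h.2 (i+1)).1 hw0.le
    · exact mul_lt_mul_of_pos_left ((h.2 (i+1)).2 (by omega)) hw0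

open Classical in
lemma dom_prod {K : Type} [NormedField K] (hna : ∀ x y : K, ‖x + y‖ ≤ max ‖x‖ ‖y‖)
    {ρ : ℝ} (hρ : 0 < ρ) (s : Multiset K) :
    Dom (s.map (fun a => X - C a)).prod (s.countP (fun a => ‖a‖ ≤ ρ)) ρ := by
  induction s using Multiset.induction_on with
  | empty =>
    refine ⟨by simp, fun i => ?_⟩
    rcases i with _ | i
    · simp
    · simp [coeff_one]
  | cons a s ih =>
    rw [Multiset.map_cons, Multiset.prod_cons]
    by_cases h : ‖a‖ ≤ ρ
    · rw [Multiset.countP_cons_of_pos (p := fun a : K => ‖a‖ ≤ ρ) _ h]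
      exact ih.step_le hna hρ a h
    · rw [Multiset.countP_cons_of_neg (p := fun a : K => ‖a‖ ≤ ρ) _ h]
      exact ih.step_gt hna hρ a (not_le.mp h)

open Classical in
lemma card_roots_le {K : Type} [NormedField K] [IsAlgClosed K]
    (hna : ∀ x y : K, ‖x + y‖ ≤ max ‖x‖ ‖y‖)
    {ρ : ℝ} (hρ : 0 < ρ) (f : K[X]) (hf : f ≠ 0) (hsep : f.Separable) (n : ℕ) (hn : Dom f n ρ) :
    Nat.card {x : K // f.eval x = 0 ∧ ‖x‖ ≤ ρ} = n := by
  have h1 : f = C f.leadingCoeff * (f.roots.map (fun a => X - C a)).prod :=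
    (IsAlgClosed.splits f).eq_prod_roots
  have h2 := (dom_prod hna hρ f.roots).const_mul f.leadingCoeff (leadingCoeff_ne_zero.mpr hf)
  rw [← h1] at h2
  rw [hn.unique h2]
  have hnd := nodup_roots hsep
  rw [Multiset.countP_eq_card_filter]
  have : ∀ x, x ∈ (f.roots.filter (fun a => ‖a‖ ≤ ρ)).toFinset ↔ (f.eval x = 0 ∧ ‖x‖ ≤ ρ) := by
    intro x; simp [hf]
  rw [← Nat.card_congr (Equiv.subtypeEquivRight this), Nat.card_eq_fintype_card, Fintype.card_coe,
    Multiset.toFinset_card_of_nodup (hnd.filter _)]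

lemma filt {F M : Type} [Field F] [AddCommGroup M] [Module F M] (s : ℕ) (d : ℕ → ℕ)
    (W : ℕ → Submodule F M) (hfin : ∀ k, k ≤ s → FiniteDimensional F (W k))
    (hd : ∀ k, k ≤ s → Module.finrank F (W k) = d k)
    (hW : ∀ k l, k ≤ l → l ≤ s → W k ≤ W l) (hdm : ∀ k l, k ≤ l → l ≤ s → d k ≤ d l) 
    (hd0 : d 0 = 0) (n : ℕ) (hn : n ≤ d s) :
    ∃ v : Fin n → M, LinearIndependent F v ∧ (∀ j, v j ∈ W s) ∧ ∀ k, 1 ≤ k → k ≤ s → ∀ j : Fin n,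
      d (k - 1) ≤ (j : ℕ) → (j : ℕ) < d k → v j ∈ W k ∧ v j ∉ W (k - 1) := by
  induction n with
  | zero => exact ⟨Fin.elim0, linearIndependent_empty_type, fun j => j.elim0, fun k _ _ j => j.elim0⟩
  | succ n ih =>
    obtain ⟨v, hv, hvs, hvk⟩ := ih (by omega)
    have hex : ∃ k, n < d k := ⟨s, hn⟩
    let k := Nat.find hex
    have hk : n < d k := Nat.find_spec hex
    have hks : k ≤ s := Nat.find_min' hex hn
    have hk1 : 1 ≤ k := by
      rcases Nat.eq_zero_or_pos k with h | h
      · rw [h, hd0] at hk; omega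
      · exact h
    have hkm : d (k - 1) ≤ n := by
      by_contra h
      exact Nat.find_min hex (show k - 1 < k by omega) (not_le.mp h)
    have huniq : ∀ l, 1 ≤ l → l ≤ s → d (l - 1) ≤ n → n < d l → l = k := by
      intro l h1 h2 h3 h4
      rcases lt_trichotomy l k with h | h | h
      · exact absurd h4 (Nat.find_min hex h)
      · exact h
      · have := hdm k (l - 1) (by omega) (by omega); omega
    have hsub : W (k - 1) ≤ Submodule.span F (Set.range v) := by
      let u : Fin (d (k - 1)) → M := fun j => v (Fin.castLE hkm j)
      have hu : LinearIndependent F u := hv.comp _ (Fin.castLE_injective hkm)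
      have huW : Submodule.span F (Set.range u) ≤ W (k - 1) := by
        rw [Submodule.span_le]
        rintro _ ⟨j, rfl⟩
        have hexj : ∃ l, (j : ℕ) < d l := ⟨k - 1, j.2⟩
        have hl := Nat.find_spec hexj
        have hlk : Nat.find hexj ≤ k - 1 := Nat.find_min' hexj j.2
        have hl1 : 1 ≤ Nat.find hexj := by
          rcases Nat.eq_zero_or_pos (Nat.find hexj) with h | h
          · rw [h, hd0] at hl; omega
          · exact h
        have hlm : d (Nat.find hexj - 1) ≤ j := by
          by_contra h
          exact Nat.find_min hexj (show Nat.find hexj - 1 < Nat.find hexj by omega) (not_le.mp h)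
        exact hW _ _ hlk (by omega)
          (hvk _ hl1 (by omega) (Fin.castLE hkm j) hlm hl).1
      have := hfin (k - 1) (by omega)
      have heq := Submodule.eq_of_le_of_finrank_eq huW (by
        rw [finrank_span_eq_card hu, hd _ (by omega), Fintype.card_fin])
      rw [← heq]
      apply Submodule.span_mono
      rintro _ ⟨j, rfl⟩
      exact ⟨_, rfl⟩
    have hnot : ¬ (W k ≤ Submodule.span F (Set.range v)) := by
      intro h
      have : FiniteDimensional F (Submodule.span F (Set.range v)) :=
        FiniteDimensional.span_of_finite F (Set.finite_range v)
      have := Submodule.finrank_mono h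
      rw [hd k hks, finrank_span_eq_card hv, Fintype.card_fin] at this
      omega
    obtain ⟨w, hw, hwn⟩ := SetLike.not_le_iff_exists.mp hnot
    refine ⟨Fin.snoc v w, linearIndependent_finSnoc.mpr ⟨hv, hwn⟩, ?_, ?_⟩
    · intro j
      refine Fin.lastCases ?_ (fun j => ?_) j
      · simp only [Fin.snoc_last]
        exact hW k s hks le_rfl hw
      · simp only [Fin.snoc_castSucc]
        exact hvs j
    intro l h1 h2 j
    refine Fin.lastCases ?_ (fun j => ?_) j
    · intro h3 h4
      simp only [Fin.val_last] at h3 h4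
      obtain rfl := huniq l h1 h2 h3 h4
      simp only [Fin.snoc_last]
      exact ⟨hw, fun h => hwn (hsub h)⟩
    · intro h3 h4
      simp only [Fin.snoc_castSucc]
      exact hvk l h1 h2 j h3 h4

def PhiP {K : Type} [NontriviallyNormedField K] (q r : ℕ) (θ : K) (A : ℕ → K) : K[X] :=
  ∑ i ∈ Finset.range (r + 1), C (Acoef K θ A i) * X ^ q ^ i

lemma PhiP_eval {K : Type} [NontriviallyNormedField K] (q r : ℕ) (θ : K) (A : ℕ → K) (x : K) :
    (PhiP q r θ A).eval x = phiT K q r θ A x := by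
  unfold PhiP phiT
  rw [eval_finsetSum, Finset.sum_range_succ', add_comm, ← Finset.Ico_add_one_right_eq_Icc,
    Finset.sum_Ico_eq_sum_range]
  simp [Acoef, add_comm]

lemma PhiP_coeff_pow {K : Type} [NontriviallyNormedField K] (q r : ℕ) (hq : 2 ≤ q)
    (θ : K) (A : ℕ → K) (n : ℕ) (hn : n ≤ r) :
    (PhiP q r θ A).coeff (q ^ n) = Acoef K θ A n := by
  unfold PhiP
  rw [finsetSum_coeff, Finset.sum_eq_single n]
  · simp
  · intro b _ hb
    rw [coeff_C_mul, coeff_X_pow, if_neg, mul_zero]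
    intro h
    exact hb (Nat.pow_right_injective hq h).symm
  · intro h; exact absurd (Finset.mem_range.mpr (by omega)) h

lemma PhiP_coeff_other {K : Type} [NontriviallyNormedField K] (q r : ℕ)
    (θ : K) (A : ℕ → K) (m : ℕ) (hm : ∀ n ≤ r, m ≠ q ^ n) :
    (PhiP q r θ A).coeff m = 0 := by
  unfold PhiP
  rw [finsetSum_coeff]
  apply Finset.sum_eq_zero
  intro n hn
  rw [coeff_C_mul, coeff_X_pow, if_neg (hm n (by simpa [Nat.lt_succ_iff] using hn)), mul_zero]

lemma PhiP_sep {K : Type} [NontriviallyNormedField K] (q r : ℕ) (hq : (q : K) = 0)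
    (θ : K) (hθ : θ ≠ 0) (A : ℕ → K) : (PhiP q r θ A).Separable := by
  have : derivative (PhiP q r θ A) = C θ := by
    unfold PhiP
    rw [derivative_sum, Finset.sum_range_succ', Finset.sum_eq_zero]
    · simp [Acoef]
    · intro i _
      simp [derivative_X_pow, hq]
  unfold Polynomial.Separable
  rw [this]
  refine ⟨0, C θ⁻¹, ?_⟩
  rw [zero_mul, zero_add, ← C_mul, inv_mul_cancel₀ hθ, C_1]

lemma norm_eq_rpow {K : Type} [NontriviallyNormedField K] (q : ℕ) (hq : 2 ≤ q) (x : K)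
    (hx : x ≠ 0) : ‖x‖ = (q : ℝ) ^ (degK K q x) := by
  have hq' : (2 : ℝ) ≤ q := by exact_mod_cast hq
  unfold degK
  rw [Real.rpow_logb (by linarith) (by linarith) (norm_pos_iff.mpr hx)]

lemma ND_d_mono {K : Type} [NontriviallyNormedField K] {q r : ℕ} {θ : K} {A : ℕ → K}
    (ND : NewtonData K q r θ A) : ∀ k l, k ≤ l → l ≤ ND.s → ND.d k ≤ ND.d l := by
  intro k l hkl
  induction l, hkl using Nat.le_induction with
  | base => intro _; exact le_rfl
  | succ l hl ih => intro h; exact (ih (by omega)).trans (ND.d_mono l (by omega)).le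

lemma dom_Phi {K : Type} [NontriviallyNormedField K] {q r : ℕ} (hq : 2 ≤ q) {θ : K} (hθ : θ ≠ 0)
    {A : ℕ → K} (ND : NewtonData K q r θ A) (k : ℕ) (hk : k ≤ ND.s) (l : ℝ)
    (h1 : 1 ≤ k → ND.lam k ≤ l) (h2 : k + 1 ≤ ND.s → l < ND.lam (k + 1)) :
    Dom (PhiP q r θ A) (q ^ ND.d k) ((q : ℝ) ^ l) := by
  have hq' : (2 : ℝ) ≤ q := by exact_mod_cast hq
  have hq0 : (0 : ℝ) < q := by linarith
  have hq1 : (1 : ℝ) < q := by linarith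
  have hdr : ND.d k ≤ r := by
    have := ND_d_mono ND k ND.s hk le_rfl
    rwa [ND.d_last] at this
  have hdk : Acoef K θ A (ND.d k) ≠ 0 := by
    unfold Acoef
    split_ifs with h
    · exact hθ
    · apply ND.vertex_ne k _ hk
      rcases Nat.eq_zero_or_pos k with h0 | h0
      · rw [h0, ND.d_zero] at h; exact absurd rfl h
      · exact h0
  have val : ∀ n, Acoef K θ A n ≠ 0 → ‖Acoef K θ A n‖ * ((q : ℝ) ^ l) ^ (q ^ n) =
      (q : ℝ) ^ (degK K q (Acoef K θ A n) + l * (q : ℝ) ^ n) := by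
    intro n hn
    rw [Real.rpow_add hq0, ← norm_eq_rpow q hq _ hn, Real.rpow_mul hq0.le]
    congr 1
    rw [← Real.rpow_natCast]
    push_cast
    rfl
  refine ⟨by rwa [PhiP_coeff_pow q r hq θ A _ hdr], fun i => ?_⟩
  rw [PhiP_coeff_pow q r hq θ A _ hdr]
  have hpos : 0 < ‖Acoef K θ A (ND.d k)‖ * ((q : ℝ) ^ l) ^ (q ^ ND.d k) :=
    mul_pos (norm_pos_iff.mpr hdk) (by positivity)
  by_cases hi : ∃ n ≤ r, i = q ^ n
  swap
  · rw [PhiP_coeff_other q r θ A i (fun n hn h => hi ⟨n, hn, h⟩), norm_zero, zero_mul]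
    exact ⟨hpos.le, fun _ => hpos⟩
  obtain ⟨n, hn, rfl⟩ := hi
  rw [PhiP_coeff_pow q r hq θ A n hn]
  by_cases hA : Acoef K θ A n = 0
  · rw [hA, norm_zero, zero_mul]
    exact ⟨hpos.le, fun _ => hpos⟩
  rw [val n hA, val _ hdk]
  have hlt : ND.d k < n → degK K q (Acoef K θ A n) + l * (q : ℝ) ^ n <
      degK K q (Acoef K θ A (ND.d k)) + l * (q : ℝ) ^ ND.d k := by
    intro hnk
    have hks : k + 1 ≤ ND.s := by
      by_contra h
      have : k = ND.s := by omega
      rw [this, ND.d_last] at hnk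
      omega
    have hh := ND.hull n hn hA (k + 1) (by omega) hks
    have hs := ND.slope_eq (k + 1) (by omega) hks
    have hl := h2 hks
    simp only [Nat.add_sub_cancel] at hs
    have hpw : (q : ℝ) ^ ND.d k < (q : ℝ) ^ ND.d (k + 1) :=
      pow_lt_pow_right₀ hq1 (ND.d_mono k (by omega))
    have hpn : (q : ℝ) ^ ND.d k < (q : ℝ) ^ n := pow_lt_pow_right₀ hq1 hnk
    rw [eq_div_iff (by linarith)] at hs
    have := mul_pos (sub_pos.mpr hl) (sub_pos.mpr hpn)
    linarith
  refine ⟨?_, fun hi => Real.rpow_lt_rpow_of_exponent_lt hq1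
    (hlt ((Nat.pow_lt_pow_iff_right (by omega)).mp hi))⟩
  apply Real.rpow_le_rpow_of_exponent_le hq1.le
  rcases lt_trichotomy n (ND.d k) with h | h | h
  · have hk1 : 1 ≤ k := by
      rcases Nat.eq_zero_or_pos k with h0 | h0
      · rw [h0, ND.d_zero] at h; omega
      · exact h0
    have hh := ND.hull n hn hA k hk1 hk
    have hl := h1 hk1
    have hpn : (q : ℝ) ^ n < (q : ℝ) ^ ND.d k := pow_lt_pow_right₀ hq1 h
    have := mul_nonneg (sub_nonneg.mpr hl) (sub_pos.mpr hpn).le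
    linarith
  · rw [h]
  · exact (hlt h).le

/-- The subfield of constants. -/
def Fq (K : Type) [Field K] (p e : ℕ) [Fact p.Prime] [CharP K p] : Subfield K :=
  RingHom.eqLocusField (iterateFrobenius K p e) (RingHom.id K)

lemma mem_Fq {K : Type} [Field K] {p e : ℕ} [Fact p.Prime] [CharP K p] {c : K} :
    c ∈ Fq K p e ↔ c ^ p ^ e = c := by
  show iterateFrobenius K p e c = RingHom.id K c ↔ _
  rw [iterateFrobenius_def]; rfl

lemma card_Fq {K : Type} [Field K] [IsAlgClosed K] {p e : ℕ} (he : 0 < e) [Fact p.Prime]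
    [CharP K p] : Nat.card (Fq K p e) = p ^ e := by
  classical
  have hp : 1 < p := (Fact.out : p.Prime).one_lt
  have hq : 1 < p ^ e := Nat.one_lt_pow he.ne' hp
  have hsep : (X ^ (p ^ e) - X : K[X]).Separable :=
    galois_poly_separable p (p ^ e) (dvd_pow_self p he.ne')
  have hne : (X ^ (p ^ e) - X : K[X]) ≠ 0 := FiniteField.X_pow_card_sub_X_ne_zero K hq
  have hdeg : (X ^ (p ^ e) - X : K[X]).natDegree = p ^ e :=
    FiniteField.X_pow_card_sub_X_natDegree_eq K hq
  have h1 := (IsAlgClosed.splits (X ^ (p ^ e) - X : K[X])).natDegree_eq_card_roots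
  have h2 : ∀ x, x ∈ (X ^ (p ^ e) - X : K[X]).roots.toFinset ↔ x ∈ Fq K p e := by
    intro x
    rw [mem_Fq]
    simp [hne, sub_eq_zero]
  have h3 : Nat.card (Fq K p e) = Nat.card (X ^ (p ^ e) - X : K[X]).roots.toFinset :=
    (Nat.card_congr (Equiv.subtypeEquivRight h2)).symm
  rw [h3, Nat.card_eq_fintype_card, Fintype.card_coe,
    Multiset.toFinset_card_of_nodup (nodup_roots hsep), ← h1, hdeg]

lemma Fq_pow {K : Type} [Field K] {p e : ℕ} [Fact p.Prime] [CharP K p] {c : K}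
    (hc : c ∈ Fq K p e) (i : ℕ) : c ^ (p ^ e) ^ i = c := by
  induction i with
  | zero => simp
  | succ i ih => rw [pow_succ, pow_mul, ih, mem_Fq.mp hc]

lemma Fq_norm {K : Type} [NormedField K] {p e : ℕ} (he : 0 < e) [Fact p.Prime] [CharP K p] {c : K}
    (hc : c ∈ Fq K p e) : ‖c‖ ≤ 1 := by
  by_contra h
  have h1 : ‖c‖ ^ p ^ e = ‖c‖ := by rw [← norm_pow, mem_Fq.mp hc]
  have hq : 1 < p ^ e := Nat.one_lt_pow he.ne' (Fact.out : p.Prime).one_lt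
  have := pow_lt_pow_right₀ (not_le.mp h) hq
  rw [h1, pow_one] at this
  exact lt_irrefl _ this

lemma phiT_add {K : Type} [NontriviallyNormedField K] {p e : ℕ} [Fact p.Prime] [CharP K p]
    (r : ℕ) (θ : K) (A : ℕ → K) (x y : K) :
    phiT K (p ^ e) r θ A (x + y) = phiT K (p ^ e) r θ A x + phiT K (p ^ e) r θ A y := by
  unfold phiT
  simp only [← pow_mul, add_pow_char_pow, mul_add, Finset.sum_add_distrib]
  ring

lemma phiT_smul {K : Type} [NontriviallyNormedField K] {p e : ℕ} [Fact p.Prime] [CharP K p]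
    (r : ℕ) (θ : K) (A : ℕ → K) (c x : K) (hc : c ∈ Fq K p e) :
    phiT K (p ^ e) r θ A (c * x) = c * phiT K (p ^ e) r θ A x := by
  unfold phiT
  simp only [mul_pow, Fq_pow hc, mul_add, Finset.mul_sum]
  congr 1
  · ring
  · apply Finset.sum_congr rfl
    intros; ring

/-- The part of `φ[t]` in the closed ball of radius `ρ`. -/
def Wsub {K : Type} [NontriviallyNormedField K] (hna : ∀ x y : K, ‖x + y‖ ≤ max ‖x‖ ‖y‖)
    (p e : ℕ) (he : 0 < e) [Fact p.Prime] [CharP K p]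
    (r : ℕ) (θ : K) (A : ℕ → K) (ρ : ℝ) (hρ : 0 < ρ) : Submodule (Fq K p e) K where
  carrier := {x | phiT K (p ^ e) r θ A x = 0 ∧ ‖x‖ ≤ ρ}
  add_mem' := by
    rintro x y ⟨hx, hx'⟩ ⟨hy, hy'⟩
    exact ⟨by rw [phiT_add, hx, hy, add_zero], (hna x y).trans (max_le hx' hy')⟩
  zero_mem' := by
    refine ⟨?_, by simpa using hρ.le⟩
    have := phiT_smul (p := p) (e := e) r θ A 0 0 (zero_mem _)
    simpa using this
  smul_mem' := by
    rintro ⟨c, hc⟩ x ⟨hx, hx'⟩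
    show phiT K (p ^ e) r θ A (c * x) = 0 ∧ ‖c * x‖ ≤ ρ
    refine ⟨by rw [phiT_smul r θ A c x hc, hx, mul_zero], ?_⟩
    rw [norm_mul]
    calc ‖c‖ * ‖x‖ ≤ 1 * ‖x‖ := mul_le_mul_of_nonneg_right (Fq_norm he hc) (norm_nonneg _)
      _ ≤ ρ := by rwa [one_mul]

theorem stmt12
    (𝕂 : Type) [NontriviallyNormedField 𝕂] [CompleteSpace 𝕂] [IsAlgClosed 𝕂]
    (hna : ∀ x y : 𝕂, ‖x + y‖ ≤ max ‖x‖ ‖y‖)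
    (p e q : ℕ) (hp : p.Prime) (hcharp : CharP 𝕂 p) (he : 0 < e) (hqpe : q = p ^ e)
    (θ : 𝕂) (hθ : ‖θ‖ = (q : ℝ))
    (r : ℕ) (hr : 0 < r) (A : ℕ → 𝕂) (hAr : A r ≠ 0)
    (ND : NewtonData 𝕂 q r θ A)
    :
    ∃ x : Fin r → 𝕂, IsFqBasis 𝕂 q r θ A x ∧ IsStrict 𝕂 q r θ A ND x := by
  classical
  subst hqpe
  have : Fact p.Prime := ⟨hp⟩
  have hqn : 1 < p ^ e := Nat.one_lt_pow he.ne' hp.one_lt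
  obtain ⟨q, hqd⟩ : ∃ q, q = p ^ e := ⟨_, rfl⟩
  have hqr : (1 : ℝ) < ((p ^ e : ℕ) : ℝ) := by exact_mod_cast hqn
  have hq0 : (0 : ℝ) < ((p ^ e : ℕ) : ℝ) := by linarith
  have hθ0 : θ ≠ 0 := by rw [← norm_pos_iff, hθ]; exact hq0
  have hqK : ((p ^ e : ℕ) : 𝕂) = 0 := by
    push_cast; rw [CharP.cast_eq_zero, zero_pow he.ne']
  have hsep := PhiP_sep (p ^ e) r hqK θ hθ0 A
  have hcount : ∀ k, k ≤ ND.s → ∀ l : ℝ, (1 ≤ k → ND.lam k ≤ l) →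
      (k + 1 ≤ ND.s → l < ND.lam (k + 1)) →
      Nat.card {x : 𝕂 // phiT 𝕂 (p ^ e) r θ A x = 0 ∧ ‖x‖ ≤ ((p ^ e : ℕ) : ℝ) ^ l}
        = (p ^ e) ^ ND.d k := by
    intro k hk l h1 h2
    have := card_roots_le hna (Real.rpow_pos_of_pos hq0 l) _ hsep.ne_zero hsep _
      (dom_Phi hqn hθ0 ND k hk l h1 h2)
    simpa only [PhiP_eval] using this
  let lam' : ℕ → ℝ := fun k => if k = 0 then ND.lam 1 - 1 else ND.lam k
  have hl1 : ∀ k, 1 ≤ k → lam' k = ND.lam k := fun k hk => if_neg (by omega)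
  have hl2 : ∀ k, k + 1 ≤ ND.s → lam' k < lam' (k + 1) := by
    intro k hk
    rw [hl1 (k + 1) (by omega)]
    rcases Nat.eq_zero_or_pos k with h0 | h0
    · subst h0
      show (if 0 = 0 then ND.lam 1 - 1 else ND.lam 0) < ND.lam 1
      rw [if_pos rfl]; linarith
    · rw [hl1 k h0]; exact ND.lam_mono k h0 hk
  have hl2' : ∀ k, k + 1 ≤ ND.s → lam' k < ND.lam (k + 1) := fun k hk => by
    rw [← hl1 (k + 1) (by omega)]; exact hl2 k hk
  have hlmono : ∀ k l, k ≤ l → l ≤ ND.s → lam' k ≤ lam' l := by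
    intro k l hkl
    induction l, hkl using Nat.le_induction with
    | base => intro _; exact le_rfl
    | succ l hl ih => intro h; exact (ih (by omega)).trans (hl2 l h).le
  let W : ℕ → Submodule (Fq 𝕂 p e) 𝕂 := fun k =>
    Wsub hna p e he r θ A (((p ^ e : ℕ) : ℝ) ^ lam' k) (Real.rpow_pos_of_pos hq0 _)
  have memW : ∀ k x, x ∈ W k ↔ phiT 𝕂 (p ^ e) r θ A x = 0 ∧
    ‖x‖ ≤ ((p ^ e : ℕ) : ℝ) ^ lam' k := fun k x => Iff.rfl
  have hcW : ∀ k, k ≤ ND.s → Nat.card (W k) = (p ^ e) ^ ND.d k := fun k hk =>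
    hcount k hk (lam' k) (fun h => (hl1 k h).ge) (hl2' k)
  have hfinset : ∀ k, k ≤ ND.s → Finite (W k) := fun k hk =>
    Nat.finite_of_card_ne_zero (by rw [hcW k hk]; positivity)
  have hFfin : Finite (Fq 𝕂 p e) :=
    Nat.finite_of_card_ne_zero (by rw [card_Fq he]; omega)
  have hfin : ∀ k, k ≤ ND.s → FiniteDimensional (Fq 𝕂 p e) (W k) := fun k hk => by
    have := hfinset k hk
    exact Module.Finite.of_finite
  have hd : ∀ k, k ≤ ND.s → Module.finrank (Fq 𝕂 p e) (W k) = ND.d k := fun k hk => by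
    have := hfin k hk
    have h := Module.natCard_eq_pow_finrank (K := Fq 𝕂 p e) (V := W k)
    rw [hcW k hk, card_Fq he] at h
    exact (Nat.pow_right_injective hqn h).symm
  have hW : ∀ k l, k ≤ l → l ≤ ND.s → W k ≤ W l := fun k l hkl hl x hx =>
    ⟨hx.1, hx.2.trans (Real.rpow_le_rpow_of_exponent_le hqr.le (hlmono k l hkl hl))⟩
  obtain ⟨v, hv, hvs, hvk⟩ :=
    filt ND.s ND.d W hfin hd hW (ND_d_mono ND) ND.d_zero r ND.d_last.ge
  have hgap : ∀ k, k ≤ ND.s → ∀ y, phiT 𝕂 (p ^ e) r θ A y = 0 → y ∉ W k →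
      (k + 1 ≤ ND.s → degK 𝕂 (p ^ e) y < ND.lam (k + 1)) → False := by
    intro k hk y hy hny hup
    have hy1 : ((p ^ e : ℕ) : ℝ) ^ lam' k < ‖y‖ := by
      by_contra h
      exact hny ⟨hy, not_lt.mp h⟩
    have hy0 : y ≠ 0 := by
      rintro rfl; exact hny (zero_mem _)
    have hye := norm_eq_rpow (p ^ e) hqn y hy0
    have hy2 := hy1
    rw [hye] at hy2
    have hlt := (Real.rpow_lt_rpow_left_iff hqr).mp hy2
    have hc := hcount k hk (degK 𝕂 (p ^ e) y) (fun h => by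
      rw [hl1 _ h] at hlt; exact hlt.le) hup
    rw [← hye] at hc
    have hc' : Set.ncard {x : 𝕂 | phiT 𝕂 (p ^ e) r θ A x = 0 ∧ ‖x‖ ≤ ‖y‖} =
        (p ^ e) ^ ND.d k := hc
    have hcW' : Set.ncard (W k : Set 𝕂) = (p ^ e) ^ ND.d k := hcW k hk
    have hsub : (W k : Set 𝕂) ⊆ {x : 𝕂 | phiT 𝕂 (p ^ e) r θ A x = 0 ∧ ‖x‖ ≤ ‖y‖} :=
      fun x hx => ⟨hx.1, hx.2.trans hy1.le⟩
    have heq := Set.eq_of_subset_of_ncard_le hsub (by rw [hc', hcW'])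
      (Set.finite_of_ncard_ne_zero (by rw [hc']; positivity))
    apply hny
    have : y ∈ {x : 𝕂 | phiT 𝕂 (p ^ e) r θ A x = 0 ∧ ‖x‖ ≤ ‖y‖} := ⟨hy, le_rfl⟩
    rw [← heq] at this
    exact this
  have hroot_mem : ∀ y, phiT 𝕂 (p ^ e) r θ A y = 0 → y ∈ W ND.s := by
    intro y hy
    by_contra hny
    exact hgap ND.s le_rfl y hy hny (fun h => by omega)
  have hspan : Submodule.span (Fq 𝕂 p e) (Set.range v) = W ND.s := by
    have hle : Submodule.span (Fq 𝕂 p e) (Set.range v) ≤ W ND.s := by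
      rw [Submodule.span_le]
      rintro _ ⟨j, rfl⟩
      exact hvs j
    have := hfin ND.s le_rfl
    exact Submodule.eq_of_le_of_finrank_eq hle (by
      rw [finrank_span_eq_card hv, hd _ le_rfl, Fintype.card_fin, ND.d_last])
  refine ⟨v, ⟨fun j => (hvs j).1, fun y hy => ?_⟩, ?_⟩
  · have hyW := hroot_mem y hy
    rw [← hspan, Submodule.mem_span_range_iff_exists_fun] at hyW
    obtain ⟨c, hc⟩ := hyW
    refine ⟨fun j => (c j : 𝕂), ⟨fun j => mem_Fq.mp (c j).2, hc.symm⟩, ?_⟩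
    rintro c' ⟨h1, h2⟩
    let c'' : Fin r → Fq 𝕂 p e := fun j => ⟨c' j, mem_Fq.mpr (h1 j)⟩
    have h3 : ∑ j, c'' j • v j = ∑ j, c j • v j := by
      rw [hc, h2]; rfl
    have h4 := hv.fintypeLinearCombination_injective
    have h5 : c'' = c := h4 (by simpa [Fintype.linearCombination_apply] using h3)
    funext j
    rw [← h5]
  · intro k hk1 hk j hj1 hj2
    obtain ⟨hm, hnm⟩ := hvk k hk1 hk j hj1 hj2
    have hv0 : v j ≠ 0 := by
      intro h; rw [h] at hnm; exact hnm (zero_mem _)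
    have hle : degK 𝕂 (p ^ e) (v j) ≤ ND.lam k := by
      have := hm.2
      rw [norm_eq_rpow (p ^ e) hqn _ hv0, hl1 k hk1] at this
      exact (Real.rpow_le_rpow_left_iff hqr).mp this
    by_contra hne
    refine hgap (k - 1) (by omega) (v j) hm.1 hnm (fun _ => ?_)
    rw [Nat.sub_add_cancel hk1]
    exact lt_of_le_of_ne hle hne


end DrinfeldRAT
end
end

section
/- Let φ be a Drinfeld module of rank r over 𝕂 and let x_1, …, x_r be a strict 𝔽_q-basis of φ[t]. Then for every 1 ≤ k ≤ s, every j with d_{k−1} + 1 ≤ j ≤ d_k, and every choice of c_1, …, c_{j−1} ∈ 𝔽_q, one has deg(c_1 x_1 + ⋯ + c_{j−1} x_{j−1} + x_j) = λ_k = deg x_j. -/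
open Filter

set_option maxHeartbeats 1000000
set_option synthInstance.maxHeartbeats 400000

noncomputable section

namespace DrinfeldRAT

variable (𝕂 : Type) [NontriviallyNormedField 𝕂]

open Polynomial in
lemma count_roots {𝕂 : Type} [NontriviallyNormedField 𝕂]
    (hna : ∀ x y : 𝕂, ‖x + y‖ ≤ max ‖x‖ ‖y‖) (ρ : ℝ) (hρ : 0 < ρ) (W : Finset 𝕂) :
    ∀ (P : 𝕂[X]) (_ : P ≠ 0) (m : ℕ), (∀ z ∈ W, P.eval z = 0 ∧ ‖z‖ < ρ) →
      (∀ n, ‖P.coeff n‖ * ρ ^ n ≤ ‖P.coeff m‖ * ρ ^ m) → W.card ≤ m := by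
  classical
  induction W using Finset.induction_on with
  | empty => intros; simp
  | insert z W hz ih =>
    intro P hP m hW hm
    obtain ⟨hz0, hzρ⟩ := hW z (Finset.mem_insert_self _ _)
    obtain ⟨R, rfl⟩ := Polynomial.dvd_iff_isRoot.mpr hz0
    have hR : R ≠ 0 := right_ne_zero_of_mul hP
    obtain ⟨n, hn, hmax⟩ := Finset.exists_max_image R.support (fun i => ‖R.coeff i‖ * ρ ^ i)
      (Polynomial.support_nonempty.mpr hR)
    have hnpos : 0 < ‖R.coeff n‖ * ρ ^ n :=
      mul_pos (norm_pos_iff.mpr (Polynomial.mem_support_iff.mp hn)) (pow_pos hρ _)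
    have hmax' : ∀ i, ‖R.coeff i‖ * ρ ^ i ≤ ‖R.coeff n‖ * ρ ^ n := by
      intro i
      by_cases h : R.coeff i = 0
      · rw [h, norm_zero, zero_mul]; exact hnpos.le
      · exact hmax i (Polynomial.mem_support_iff.mpr h)
    set M := ‖R.coeff n‖ * ρ ^ n with hM
    have hzR : ∀ i, ‖z * R.coeff i‖ * ρ ^ i < ρ * M := by
      intro i
      rw [norm_mul, mul_assoc]
      calc ‖z‖ * (‖R.coeff i‖ * ρ ^ i) ≤ ‖z‖ * M :=
            mul_le_mul_of_nonneg_left (hmax' i) (norm_nonneg _)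
        _ < ρ * M := mul_lt_mul_of_pos_right hzρ hnpos
    have hcoef : ∀ i, ((X - C z) * R).coeff (i + 1) = R.coeff i - z * R.coeff (i + 1) := by
      intro i; rw [sub_mul, coeff_sub, coeff_X_mul, coeff_C_mul]
    have hcoef0 : ((X - C z) * R).coeff 0 = - (z * R.coeff 0) := by
      rw [sub_mul, coeff_sub, coeff_X_mul_zero, coeff_C_mul, zero_sub]
    have key : ρ * M ≤ ‖((X - C z) * R).coeff m‖ * ρ ^ m := by
      refine le_trans ?_ (hm (n + 1))
      by_contra! hlt
      have h1 := hna (((X - C z) * R).coeff (n + 1)) (z * R.coeff (n + 1))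
      rw [hcoef] at h1 hlt
      rw [sub_add_cancel] at h1
      have h2 : ρ * M = ‖R.coeff n‖ * ρ ^ (n + 1) := by rw [hM]; ring
      have h3 := mul_le_mul_of_nonneg_right h1 (pow_pos hρ (n + 1)).le
      rw [max_mul_of_nonneg _ _ (pow_pos hρ (n + 1)).le, ← h2] at h3
      exact absurd h3 (not_le.mpr (max_lt hlt (hzR _)))
    cases m with
    | zero =>
      rw [hcoef0, norm_neg] at key
      exact absurd key (not_le.mpr (hzR 0))
    | succ m =>
      rw [Finset.card_insert_of_notMem hz]
      apply Nat.succ_le_succ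
      refine ih R hR m ?_ ?_
      · intro w hw
        obtain ⟨h1, h2⟩ := hW w (Finset.mem_insert_of_mem hw)
        refine ⟨?_, h2⟩
        rw [eval_mul, eval_sub, eval_X, eval_C] at h1
        rcases mul_eq_zero.mp h1 with h | h
        · exact absurd (sub_eq_zero.mp h ▸ hw) hz
        · exact h
      · intro i
        refine (hmax' i).trans ?_
        rw [hcoef] at key
        by_contra! hlt
        have h1 := hna (R.coeff m) (-(z * R.coeff (m + 1)))
        rw [← sub_eq_add_neg, norm_neg] at h1
        have h3 := mul_le_mul_of_nonneg_right h1 (pow_pos hρ (m + 1)).le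
        rw [max_mul_of_nonneg _ _ (pow_pos hρ (m + 1)).le] at h3
        have h4 : ‖R.coeff m‖ * ρ ^ (m + 1) < ρ * M := by
          calc _ = ρ * (‖R.coeff m‖ * ρ ^ m) := by ring
            _ < _ := mul_lt_mul_of_pos_left hlt hρ
        exact absurd (key.trans h3) (not_le.mpr (max_lt h4 (hzR _)))

open Polynomial in
/-- `φ_t` as a polynomial. -/
def phiPoly (𝕂 : Type) [NontriviallyNormedField 𝕂] (q r : ℕ) (θ : 𝕂) (A : ℕ → 𝕂) : 𝕂[X] :=
  ∑ i ∈ Finset.range (r + 1), C (Acoef 𝕂 θ A i) * X ^ q ^ i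

lemma phiT_eq_sum {𝕂 : Type} [NontriviallyNormedField 𝕂] (q r : ℕ) (θ : 𝕂) (A : ℕ → 𝕂) (y : 𝕂) :
    phiT 𝕂 q r θ A y = ∑ i ∈ Finset.range (r + 1), Acoef 𝕂 θ A i * y ^ q ^ i := by
  rw [Finset.sum_range_succ', phiT, add_comm]
  congr 1
  · rw [Finset.range_eq_Ico, Finset.sum_Ico_add' (fun i => Acoef 𝕂 θ A i * y ^ q ^ i) 0 r 1]
    refine Finset.sum_congr (by ext i; simp only [Finset.mem_Ico, Finset.mem_Icc]; omega) ?_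
    intro i hi
    have : i ≠ 0 := by simp at hi; omega
    simp [Acoef, this]
  · simp [Acoef]

lemma phiPoly_eval {𝕂 : Type} [NontriviallyNormedField 𝕂] (q r : ℕ) (θ : 𝕂) (A : ℕ → 𝕂) (y : 𝕂) :
    (phiPoly 𝕂 q r θ A).eval y = phiT 𝕂 q r θ A y := by
  rw [phiT_eq_sum, phiPoly, Polynomial.eval_finset_sum]
  simp

lemma phiPoly_coeff {𝕂 : Type} [NontriviallyNormedField 𝕂] (q r : ℕ) (hq : 2 ≤ q) (θ : 𝕂)
    (A : ℕ → 𝕂) (n : ℕ) (hn : n ≤ r) :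
    (phiPoly 𝕂 q r θ A).coeff (q ^ n) = Acoef 𝕂 θ A n := by
  rw [phiPoly, Polynomial.finset_sum_coeff, Finset.sum_eq_single n]
  · simp
  · intro b _ hb
    rw [Polynomial.coeff_C_mul_X_pow, if_neg]
    intro h
    exact hb (Nat.pow_right_injective hq h).symm
  · intro h; simp at h; omega

lemma phiPoly_coeff' {𝕂 : Type} [NontriviallyNormedField 𝕂] (q r : ℕ) (θ : 𝕂)
    (A : ℕ → 𝕂) (n : ℕ) (hn : ∀ i ≤ r, n ≠ q ^ i) :
    (phiPoly 𝕂 q r θ A).coeff n = 0 := by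
  rw [phiPoly, Polynomial.finset_sum_coeff]
  refine Finset.sum_eq_zero fun i hi => ?_
  rw [Polynomial.coeff_C_mul_X_pow, if_neg]
  exact hn i (by simp at hi; omega)

lemma phiT_lin {𝕂 : Type} [NontriviallyNormedField 𝕂] (p e q : ℕ) (hp : p.Prime)
    (hcharp : CharP 𝕂 p) (hqpe : q = p ^ e) (r : ℕ) (θ : 𝕂) (A : ℕ → 𝕂)
    {ι : Type} (S : Finset ι) (c x : ι → 𝕂) (hc : ∀ l ∈ S, c l ^ q = c l)
    (hx : ∀ l ∈ S, phiT 𝕂 q r θ A (x l) = 0) :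
    phiT 𝕂 q r θ A (∑ l ∈ S, c l * x l) = 0 := by
  haveI := Fact.mk hp
  haveI : ExpChar 𝕂 p := ExpChar.prime hp
  have hpow : ∀ l ∈ S, ∀ i, c l ^ q ^ i = c l := by
    intro l hl i
    induction i with
    | zero => simp
    | succ i ih => rw [pow_succ, pow_mul, ih, hc l hl]
  have h2 : ∀ i, (∑ l ∈ S, c l * x l) ^ q ^ i = ∑ l ∈ S, c l * x l ^ q ^ i := by
    intro i
    rw [hqpe, ← pow_mul, sum_pow_char_pow]
    refine Finset.sum_congr rfl fun l hl => ?_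
    rw [mul_pow, pow_mul, ← hqpe, hpow l hl]
  have h3 : phiT 𝕂 q r θ A (∑ l ∈ S, c l * x l) = ∑ l ∈ S, c l * phiT 𝕂 q r θ A (x l) := by
    simp_rw [phiT_eq_sum, h2, Finset.mul_sum]
    rw [Finset.sum_comm]
    refine Finset.sum_congr rfl fun l hl => Finset.sum_congr rfl fun i hi => by ring
  rw [h3]
  exact Finset.sum_eq_zero fun l hl => by rw [hx l hl, mul_zero]

open Polynomial in
lemma card_fq {𝕂 : Type} [NontriviallyNormedField 𝕂] [IsAlgClosed 𝕂] (p e q : ℕ) (hp : p.Prime)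
    (hcharp : CharP 𝕂 p) (he : 0 < e) (hqpe : q = p ^ e) :
    ∃ F : Finset 𝕂, F.card = q ∧ ∀ c ∈ F, c ^ q = c := by
  classical
  haveI := Fact.mk hp
  have hq1 : 1 < q := hqpe ▸ Nat.one_lt_pow he.ne' hp.one_lt
  have hsep : (X ^ q - X : 𝕂[X]).Separable :=
    galois_poly_separable p q (hqpe ▸ dvd_pow_self p he.ne')
  have hdeg : (X ^ q - X : 𝕂[X]).natDegree = q := FiniteField.X_pow_card_sub_X_natDegree_eq 𝕂 hq1
  refine ⟨(X ^ q - X : 𝕂[X]).roots.toFinset, ?_, ?_⟩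
  · rw [Multiset.toFinset_card_of_nodup (nodup_roots hsep),
      splits_iff_card_roots.mp (IsAlgClosed.splits _), hdeg]
  · intro c hc
    rw [Multiset.mem_toFinset] at hc
    have := isRoot_of_mem_roots hc
    simpa [sub_eq_zero] using this

lemma norm_sum_le_na {𝕂 : Type} [NontriviallyNormedField 𝕂]
    (hna : ∀ x y : 𝕂, ‖x + y‖ ≤ max ‖x‖ ‖y‖) {ι : Type} (S : Finset ι) (f : ι → 𝕂)
    (P : ℝ → Prop) (hP0 : P 0) (hPle : ∀ a b, a ≤ b → P b → P a) (h : ∀ l ∈ S, P ‖f l‖) :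
    P ‖∑ l ∈ S, f l‖ := by
  classical
  induction S using Finset.induction_on with
  | empty => simpa using hP0
  | insert a S ha ih =>
    rw [Finset.sum_insert ha]
    refine hPle _ _ (hna _ _) ?_
    rcases max_choice ‖f a‖ ‖∑ l ∈ S, f l‖ with h' | h' <;> rw [h']
    · exact h a (Finset.mem_insert_self _ _)
    · exact ih fun l hl => h l (Finset.mem_insert_of_mem hl)

lemma norm_fq_le {𝕂 : Type} [NontriviallyNormedField 𝕂] (q : ℕ) (hq : 2 ≤ q) (c : 𝕂)
    (hc : c ^ q = c) : ‖c‖ ≤ 1 := by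
  by_contra! h
  have h1 : ‖c‖ ^ q = ‖c‖ := by rw [← norm_pow, hc]
  have h2 : ‖c‖ ^ 1 < ‖c‖ ^ q := pow_lt_pow_right₀ h (by omega)
  rw [pow_one, h1] at h2
  exact lt_irrefl _ h2

theorem stmt13
    (𝕂 : Type) [NontriviallyNormedField 𝕂] [CompleteSpace 𝕂] [IsAlgClosed 𝕂]
    (hna : ∀ x y : 𝕂, ‖x + y‖ ≤ max ‖x‖ ‖y‖)
    (p e q : ℕ) (hp : p.Prime) (hcharp : CharP 𝕂 p) (he : 0 < e) (hqpe : q = p ^ e)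
    (θ : 𝕂) (hθ : ‖θ‖ = (q : ℝ))
    (r : ℕ) (hr : 0 < r) (A : ℕ → 𝕂) (hAr : A r ≠ 0)
    (ND : NewtonData 𝕂 q r θ A)
    (x : Fin r → 𝕂) (hxb : IsFqBasis 𝕂 q r θ A x) (hxs : IsStrict 𝕂 q r θ A ND x)
    :
    ∀ k, 1 ≤ k → k ≤ ND.s → ∀ j : Fin r, ND.d (k - 1) ≤ (j : ℕ) → (j : ℕ) < ND.d k →
      ∀ c : Fin r → 𝕂, (∀ l, c l ^ q = c l) →
        degK 𝕂 q ((∑ l ∈ Finset.univ.filter (· < j), c l * x l) + x j) = ND.lam k ∧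
          ND.lam k = degK 𝕂 q (x j) := by
  classical
  have hq : 2 ≤ q := hqpe ▸ Nat.one_lt_pow he.ne' hp.one_lt
  have hq1 : (1 : ℝ) < q := by exact_mod_cast hq
  have hq0 : (0 : ℝ) < q := by linarith
  have hqpos : 0 < q := by omega
  have h0q : (0 : 𝕂) ^ q = 0 := zero_pow (by omega)
  -- norms from degrees
  have hnorm : ∀ z : 𝕂, z ≠ 0 → ‖z‖ = (q : ℝ) ^ (degK 𝕂 q z) := by
    intro z hz
    rw [degK, Real.rpow_logb hq0 hq1.ne' (norm_pos_iff.mpr hz)]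
  -- uniqueness of coordinates
  have huniq : ∀ c c' : Fin r → 𝕂, (∀ l, c l ^ q = c l) → (∀ l, c' l ^ q = c' l) →
      ∑ l, c l * x l = ∑ l, c' l * x l → c = c' := by
    intro c c' hc hc' h
    have hz := phiT_lin p e q hp hcharp hqpe r θ A Finset.univ c x (fun l _ => hc l)
      (fun l _ => hxb.1 l)
    exact (hxb.2 _ hz).unique ⟨hc, rfl⟩ ⟨hc', h⟩
  have hx0 : ∀ l, x l ≠ 0 := by
    intro l hl
    have h := huniq (Pi.single l 1) 0
      (fun i => by by_cases h : i = l
                   · subst h; simp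
                   · simp [h, h0q]) (fun i => by simp [h0q])
      (by simp [Pi.single_apply, hl])
    have := congrFun h l
    simp at this
  -- monotonicity of slopes
  have hlam : ∀ b, b ≤ ND.s → ∀ a, 1 ≤ a → a ≤ b → ND.lam a ≤ ND.lam b ∧
      (a < b → ND.lam a < ND.lam b) := by
    intro b
    induction b with
    | zero => intro _ a h1 h2; omega
    | succ b ih =>
      intro hb a h1 h2
      rcases Nat.lt_or_ge a (b + 1) with h | h
      · have h3 := (ih (by omega) a h1 (by omega)).1
        have h4 := ND.lam_mono b (by omega) hb
        exact ⟨by linarith, fun _ => by linarith⟩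
      · have : a = b + 1 := by omega
        subst this
        exact ⟨le_rfl, fun h => absurd h (lt_irrefl _)⟩
  have hfind : ∀ b, b ≤ ND.s → ∀ l : ℕ, l < ND.d b →
      ∃ a, 1 ≤ a ∧ a ≤ b ∧ ND.d (a - 1) ≤ l ∧ l < ND.d a := by
    intro b
    induction b with
    | zero => intro _ l hl; rw [ND.d_zero] at hl; omega
    | succ b ih =>
      intro hb l hl
      rcases Nat.lt_or_ge l (ND.d b) with h | h
      · obtain ⟨a, h1, h2, h3⟩ := ih (by omega) l h
        exact ⟨a, h1, by omega, h3⟩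
      · exact ⟨b + 1, by omega, le_rfl, h, hl⟩
  have hdr : ∀ i, i ≤ ND.s → ND.d (ND.s - i) ≤ r := by
    intro i
    induction i with
    | zero => intro _; simp [ND.d_last]
    | succ i ih =>
      intro hi
      have h1 := ih (by omega)
      have h2 := ND.d_mono (ND.s - (i + 1)) (by omega)
      rw [show ND.s - (i + 1) + 1 = ND.s - i by omega] at h2
      omega
  have hdr' : ∀ i, i ≤ ND.s → ND.d i ≤ r := by
    intro i hi
    have := hdr (ND.s - i) (by omega)
    rwa [show ND.s - (ND.s - i) = i by omega] at this
  intro k hk1 hks j hj1 hj2 c hc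
  have hxj : degK 𝕂 q (x j) = ND.lam k := hxs k hk1 hks j hj1 hj2
  refine ⟨?_, hxj.symm⟩
  set ρ : ℝ := (q : ℝ) ^ ND.lam k with hρ
  have hρ0 : 0 < ρ := Real.rpow_pos_of_pos hq0 _
  have hxle : ∀ l : Fin r, (l : ℕ) < ND.d k → ‖x l‖ ≤ ρ := by
    intro l hl
    obtain ⟨a, h1, h2, h3, h4⟩ := hfind k hks l hl
    rw [hnorm _ (hx0 l), hxs a h1 (by omega) l h3 h4]
    exact Real.rpow_le_rpow_of_exponent_le hq1.le (hlam k hks a h1 h2).1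
  have hxlt : ∀ l : Fin r, (l : ℕ) < ND.d (k - 1) → ‖x l‖ < ρ := by
    intro l hl
    obtain ⟨a, h1, h2, h3, h4⟩ := hfind (k - 1) (by omega) l hl
    rw [hnorm _ (hx0 l), hxs a h1 (by omega) l h3 h4]
    exact Real.rpow_lt_rpow_of_exponent_lt hq1 ((hlam k hks a h1 (by omega)).2 (by omega))
  have hcx : ∀ (c z : 𝕂), c ^ q = c → ‖c * z‖ ≤ ‖z‖ := by
    intro c z hc
    rw [norm_mul]
    exact mul_le_of_le_one_left (norm_nonneg _) (norm_fq_le q hq c hc)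
  -- full coordinates of `y`
  set y := (∑ l ∈ Finset.univ.filter (· < j), c l * x l) + x j with hy
  set cy : Fin r → 𝕂 := fun l => if l < j then c l else if l = j then 1 else 0 with hcy
  have hcyq : ∀ l, cy l ^ q = cy l := by
    intro l
    simp only [hcy]
    split_ifs
    · exact hc l
    · exact one_pow _
    · exact h0q
  have hycy : y = ∑ l, cy l * x l := by
    have h1 : ∀ l, cy l * x l = (if l < j then c l * x l else 0) + if l = j then x l else 0 := by
      intro l
      simp only [hcy]
      by_cases h : l < j
      · simp [h, h.ne]
      · by_cases h' : l = j <;> simp [h, h']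
    simp_rw [h1]
    rw [Finset.sum_add_distrib, Finset.sum_ite_eq' Finset.univ j x, hy, Finset.sum_filter]
    simp
  have hcyj : cy j = 1 := by simp [hcy]
  have hyle : ‖y‖ ≤ ρ := by
    refine (hna _ _).trans (max_le ?_ (hxle j hj2))
    refine norm_sum_le_na hna _ _ (fun a => a ≤ ρ) hρ0.le (fun a b h1 h2 => h1.trans h2) ?_
    intro l hl
    rw [Finset.mem_filter] at hl
    have hl2 : (l : ℕ) < (j : ℕ) := hl.2
    exact (hcx _ _ (hc l)).trans (hxle l (by omega))
  suffices hge : ρ ≤ ‖y‖ by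
    rw [degK, le_antisymm hyle hge, hρ, Real.logb_rpow hq0 hq1.ne']
  by_contra! hlt
  obtain ⟨F, hFcard, hF⟩ := card_fq (𝕂 := 𝕂) p e q hp hcharp he hqpe
  set D := ND.d (k - 1) with hD
  have hDr : D ≤ r := hdr' _ (by omega)
  -- coordinates of small elements
  let ext : (Fin D → F) → (Fin r → 𝕂) := fun v l => if h : (l : ℕ) < D then (v ⟨l, h⟩ : 𝕂) else 0
  have hextq : ∀ v l, ext v l ^ q = ext v l := by
    intro v l
    simp only [ext]
    split_ifs with h
    · exact hF _ (v ⟨l, h⟩).2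
    · exact h0q
  let g : (Fin D → F) → 𝕂 := fun v => ∑ l, ext v l * x l
  have hg : Function.Injective g := by
    intro v w hvw
    have h := huniq _ _ (hextq v) (hextq w) hvw
    funext i
    have h1 := congrFun h ⟨i, by omega⟩
    simp only [ext, Fin.is_lt, dif_pos] at h1
    exact Subtype.ext h1
  have hyg : y ∉ Finset.univ.image g := by
    intro h
    obtain ⟨v, _, hv⟩ := Finset.mem_image.mp h
    have h1 := congrFun (huniq _ _ (hextq v) hcyq (hv.trans hycy)) j
    rw [hcyj] at h1
    simp only [ext, dif_neg (not_lt.mpr hj1)] at h1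
    exact zero_ne_one h1
  have hcardW : (insert y (Finset.univ.image g)).card = q ^ D + 1 := by
    rw [Finset.card_insert_of_notMem hyg, Finset.card_image_of_injective _ hg, Finset.card_univ,
      Fintype.card_fun, Fintype.card_coe, hFcard, Fintype.card_fin]
  -- Newton polygon
  have hAk : Acoef 𝕂 θ A (ND.d k) ≠ 0 := by
    have h1 : ND.d k ≠ 0 := by omega
    rw [Acoef, if_neg h1]
    exact ND.vertex_ne k hk1 hks
  have hθ0 : θ ≠ 0 := by
    rw [← norm_pos_iff, hθ]; exact hq0
  have hAD : Acoef 𝕂 θ A D ≠ 0 := by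
    rw [Acoef]
    split_ifs with h
    · exact hθ0
    · have hk2 : 1 ≤ k - 1 := by
        by_contra h2
        have : k - 1 = 0 := by omega
        rw [hD, this, ND.d_zero] at h
        exact h rfl
      exact ND.vertex_ne (k - 1) hk2 (by omega)
  have hval : ∀ n, Acoef 𝕂 θ A n ≠ 0 → ‖Acoef 𝕂 θ A n‖ * ρ ^ q ^ n =
      (q : ℝ) ^ (degK 𝕂 q (Acoef 𝕂 θ A n) + ND.lam k * (q : ℝ) ^ n) := by
    intro n hn
    rw [Real.rpow_add hq0, ← hnorm _ hn, hρ, Real.rpow_mul hq0.le]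
    congr 1
    rw [← Real.rpow_natCast]
    push_cast
    rfl
  have hslope := ND.slope_eq k hk1 hks
  have hDk : D < ND.d k := by omega
  have hden : (0 : ℝ) < (q : ℝ) ^ ND.d k - (q : ℝ) ^ ND.d (k - 1) :=
    sub_pos.mpr (pow_lt_pow_right₀ hq1 hDk)
  rw [eq_div_iff hden.ne'] at hslope
  have hcount := count_roots hna ρ hρ0 (insert y (Finset.univ.image g)) (phiPoly 𝕂 q r θ A)
    (by
      intro h
      have h1 := phiPoly_coeff q r hq θ A D hDr
      rw [h, Polynomial.coeff_zero] at h1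
      exact hAD h1.symm) (q ^ D)
    (by
      intro z hz
      rw [phiPoly_eval]
      rcases Finset.mem_insert.mp hz with rfl | hz
      · refine ⟨?_, hlt⟩
        rw [hycy]
        exact phiT_lin p e q hp hcharp hqpe r θ A _ _ _ (fun l _ => hcyq l) (fun l _ => hxb.1 l)
      · obtain ⟨v, _, rfl⟩ := Finset.mem_image.mp hz
        refine ⟨phiT_lin p e q hp hcharp hqpe r θ A _ _ _ (fun l _ => hextq v l)
          (fun l _ => hxb.1 l), ?_⟩
        refine norm_sum_le_na hna _ _ (fun a => a < ρ) hρ0 (fun a b h1 h2 => h1.trans_lt h2) ?_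
        intro l _
        by_cases h : (l : ℕ) < D
        · exact (hcx _ _ (hextq v l)).trans_lt (hxlt l h)
        · simp only [ext, dif_neg h, zero_mul, norm_zero]
          exact hρ0)
    (by
      intro n
      rw [phiPoly_coeff q r hq θ A D hDr]
      by_cases hn : ∃ i ≤ r, n = q ^ i
      · obtain ⟨i, hir, rfl⟩ := hn
        rw [phiPoly_coeff q r hq θ A i hir]
        by_cases hi0 : Acoef 𝕂 θ A i = 0
        · rw [hi0, norm_zero, zero_mul]
          positivity
        · rw [hval i hi0, hval D hAD]
          apply Real.rpow_le_rpow_of_exponent_le hq1.le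
          have h1 := ND.hull i hir hi0 k hk1 hks
          rw [← hD] at hslope
          linarith
      · push Not at hn
        rw [phiPoly_coeff' q r θ A n hn, norm_zero, zero_mul]
        positivity)
  omega


end DrinfeldRAT
end
end

section
/- Let φ be a Drinfeld module of rank r over 𝕂, let x_1, …, x_r be a strict 𝔽_q-basis of φ[t], and let X ∈ Mat_r(𝕂) be the Moore matrix with (i,j) entry x_j^{q^{i−1}}. Then det X ≠ 0 and deg(det X) = Σ_{j=1}^r q^{j−1} · deg x_j. -/
open Filter

set_option maxHeartbeats 1000000
set_option synthInstance.maxHeartbeats 400000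

noncomputable section

namespace DrinfeldRAT

variable (𝕂 : Type) [NontriviallyNormedField 𝕂]

theorem exists_fixed_of_stable {K : Type} [Field K] {r : ℕ} (F : K →+* K)
    (W : Submodule K (Fin r → K)) (hW : ∀ v ∈ W, (fun j => F (v j)) ∈ W) :
    ∀ n : ℕ, ∀ v ∈ W, v ≠ 0 → (Set.ncard {j | v j ≠ 0}) = n →
      ∃ c ∈ W, c ≠ 0 ∧ ∀ j, F (c j) = c j := by
  intro n
  induction n using Nat.strong_induction_on with
  | _ n ih =>
    intro v hv hv0 hn
    obtain ⟨j0, hj0⟩ : ∃ j, v j ≠ 0 := by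
      by_contra hcon
      push Not at hcon
      exact hv0 (funext hcon)
    set w : Fin r → K := (v j0)⁻¹ • v with hw
    have hwW : w ∈ W := W.smul_mem _ hv
    have hw1 : w j0 = 1 := by simp [hw, hj0]
    have hw0 : w ≠ 0 := fun h => by
      rw [h] at hw1
      simp at hw1
    set u : Fin r → K := (fun j => F (w j)) - w with hu
    have huW : u ∈ W := W.sub_mem (hW w hwW) hwW
    by_cases hu0 : u = 0
    · refine ⟨w, hwW, hw0, fun j => ?_⟩
      have := congrFun hu0 j
      simpa [hu, sub_eq_zero] using this
    · refine ih _ ?_ u huW hu0 rfl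
      rw [← hn]
      apply Set.ncard_lt_ncard _ (Set.toFinite _)
      rw [Set.ssubset_iff_of_subset]
      · refine ⟨j0, hj0, ?_⟩
        simp [hu, hw1]
      · intro j hj hvj
        apply hj
        simp [hu, hw, hvj]

theorem moore_det_ne_zero (K : Type) [NontriviallyNormedField K] (q r : ℕ) (F : K →+* K)
    (hF : ∀ y, F y = y ^ q) (hq : 0 < q)
    (θ : K) (hθ : θ ≠ 0) (A : ℕ → K) (x : Fin r → K) (hxb : IsFqBasis K q r θ A x) :
    (Matrix.of fun i j : Fin r => x j ^ q ^ (i : ℕ)).det ≠ 0 := by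
  intro hdet
  obtain ⟨v, hv0, hv⟩ := Matrix.exists_mulVec_eq_zero_iff.mpr hdet
  set X := (Matrix.of fun i j : Fin r => x j ^ q ^ (i : ℕ)) with hX
  have key : ∀ v : Fin r → K, v ∈ LinearMap.ker X.mulVecLin ↔
      ∀ i : ℕ, i < r → ∑ j, x j ^ q ^ i * v j = 0 := by
    intro v
    rw [LinearMap.mem_ker, Matrix.mulVecLin_apply, funext_iff]
    constructor
    · intro h i hi
      exact h ⟨i, hi⟩
    · intro h i
      exact h i i.2
  have hstab : ∀ v ∈ LinearMap.ker X.mulVecLin,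
      (fun j => F (v j)) ∈ LinearMap.ker X.mulVecLin := by
    intro v hv
    rw [key] at hv ⊢
    have h1 : ∀ i : ℕ, i < r → ∑ j, x j ^ q ^ (i + 1) * F (v j) = 0 := by
      intro i hi
      have := congrArg F (hv i hi)
      rw [map_sum, map_zero] at this
      rw [← this]
      refine Finset.sum_congr rfl fun j _ => ?_
      rw [map_mul, hF (x j ^ q ^ i), ← pow_mul, pow_succ]
    intro i hi
    rcases i with _ | i
    · have h2 : ∑ j, phiT K q r θ A (x j) * F (v j) = 0 := by
        simp [hxb.1]
      have h3 : ∑ j, phiT K q r θ A (x j) * F (v j) = θ * ∑ j, x j ^ q ^ 0 * F (v j) +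
          ∑ i ∈ Finset.Icc 1 r, A i * ∑ j, x j ^ q ^ i * F (v j) := by
        simp only [phiT, add_mul, Finset.sum_add_distrib, Finset.sum_mul, Finset.mul_sum]
        rw [Finset.sum_comm (s := Finset.Icc 1 r)]
        simp [mul_assoc]
      have h4 : ∑ i ∈ Finset.Icc 1 r, A i * ∑ j, x j ^ q ^ i * F (v j) = 0 := by
        refine Finset.sum_eq_zero fun i hi => ?_
        rw [Finset.mem_Icc] at hi
        obtain ⟨i, rfl⟩ : ∃ k, i = k + 1 := ⟨i - 1, by omega⟩
        rw [h1 i (by omega), mul_zero]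
      rw [h2, h4, add_zero] at h3
      exact (mul_eq_zero.mp h3.symm).resolve_left hθ
    · exact h1 i (by omega)
  obtain ⟨c, hc, hc0, hcF⟩ := exists_fixed_of_stable F (LinearMap.ker X.mulVecLin) hstab _ v
    (by simpa [LinearMap.mem_ker] using hv) hv0 rfl
  have hr : 0 < r := by
    rcases Nat.eq_zero_or_pos r with h | h
    · subst h
      exact absurd (Subsingleton.elim _ _) hc0
    · exact h
  have h0 := (key c).mp hc 0 hr
  have hphi0 : phiT K q r θ A 0 = 0 := by
    simp [phiT, hq.ne']
  obtain ⟨c', _, huniq⟩ := hxb.2 0 hphi0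
  have e1 := huniq c ⟨fun j => by rw [← hF, hcF], by
    rw [← h0]
    exact Finset.sum_congr rfl fun j _ => by simp [mul_comm]⟩
  have e2 := huniq 0 ⟨fun j => by simp [hq.ne'], by simp⟩
  exact hc0 (e1.trans e2.symm)

theorem moore_det_norm (K : Type) [NontriviallyNormedField K] (q r : ℕ) (F : K →+* K)
    (hF : ∀ y, F y = y ^ q) (hr : 0 < r)
    (θ : K) (A : ℕ → K) (hA : A r ≠ 0) (x : Fin r → K) (hx : ∀ j, phiT K q r θ A (x j) = 0) :
    ‖(Matrix.of fun i j : Fin r => x j ^ q ^ (i : ℕ)).det‖ ^ q * ‖A r‖ =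
      ‖θ‖ * ‖(Matrix.of fun i j : Fin r => x j ^ q ^ (i : ℕ)).det‖ := by
  obtain ⟨n, rfl⟩ : ∃ n, r = n + 1 := ⟨r - 1, by omega⟩
  set X := (Matrix.of fun i j : Fin (n + 1) => x j ^ q ^ (i : ℕ)) with hX
  set Y := X.submatrix (finRotate (n + 1)) id with hY
  set c : Fin (n + 1) → K := fun k => if k = Fin.last n then -θ / A (n + 1)
    else -A (k + 1) / A (n + 1) with hc
  have hYlast : ∀ j, Y (Fin.last n) j = x j := by
    intro j
    simp [hY, hX]
  have hYcast : ∀ (k : Fin n) j, Y k.castSucc j = x j ^ q ^ ((k : ℕ) + 1) := by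
    intro k j
    have : finRotate (n + 1) k.castSucc = k.succ := by
      rw [finRotate_succ_apply]
      simp
    simp [hY, hX, this]
  have hdet : F.mapMatrix X = Y.updateRow (Fin.last n) (∑ k, c k • Y k) := by
    ext i j
    rw [RingHom.mapMatrix_apply, Matrix.map_apply, hF]
    refine Fin.lastCases ?_ (fun i => ?_) i
    · rw [Matrix.updateRow_self, Finset.sum_apply, Fin.sum_univ_castSucc]
      simp only [Pi.smul_apply, hYlast, hYcast, smul_eq_mul]
      have h := hx j
      rw [phiT, Finset.sum_Icc_succ_top (by omega)] at h
      have h5 : ∑ i ∈ Finset.Icc 1 n, A i * x j ^ q ^ i =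
          ∑ k : Fin n, A ((k : ℕ) + 1) * x j ^ q ^ ((k : ℕ) + 1) := by
        rw [Fin.sum_univ_eq_sum_range (fun k => A (k + 1) * x j ^ q ^ (k + 1)),
          Finset.range_eq_Ico, Finset.sum_Ico_add' (fun k => A k * x j ^ q ^ k)]
        rfl
      have h6 : ∑ k : Fin n, c k.castSucc * x j ^ q ^ ((k : ℕ) + 1) =
          -(∑ k : Fin n, A ((k : ℕ) + 1) * x j ^ q ^ ((k : ℕ) + 1)) / A (n + 1) := by
        rw [neg_div, Finset.sum_div, ← Finset.sum_neg_distrib]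
        refine Finset.sum_congr rfl fun k _ => ?_
        have : k.castSucc ≠ Fin.last n := (Fin.castSucc_lt_last k).ne
        simp only [hc, if_neg this, Fin.val_castSucc]
        ring
      rw [h5] at h
      rw [h6]
      have : c (Fin.last n) = -θ / A (n + 1) := by simp [hc]
      rw [this]
      have h7 : X (Fin.last n) j ^ q = x j ^ q ^ (n + 1) := by
        simp [hX, ← pow_mul, pow_succ]
      rw [h7]
      field_simp
      linear_combination h
    · rw [Matrix.updateRow_ne (Fin.castSucc_lt_last i).ne, hYcast]
      simp [hX, ← pow_mul, pow_succ]
  have h1 := congrArg Matrix.det hdet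
  rw [Matrix.det_updateRow_sum, ← RingHom.map_det, hF, hY, Matrix.det_permute] at h1
  have h2 := congrArg norm h1
  have hs : ‖((Equiv.Perm.sign (finRotate (n + 1)) : ℤ) : K)‖ = 1 := by
    rcases Int.units_eq_one_or (Equiv.Perm.sign (finRotate (n + 1))) with h | h <;> rw [h] <;> simp
  have hcl : c (Fin.last n) = -θ / A (n + 1) := by simp [hc]
  rw [norm_pow, hcl, smul_eq_mul, norm_mul, norm_mul, hs, one_mul, norm_div, norm_neg] at h2
  have : ‖A (n + 1)‖ ≠ 0 := norm_ne_zero_iff.mpr hA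
  rw [h2]
  field_simp

theorem newton_sum (K : Type) [NontriviallyNormedField K] (q r : ℕ) (hq : 1 < q)
    (θ : K) (A : ℕ → K) (ND : NewtonData K q r θ A) (f : ℕ → ℝ)
    (hf : ∀ k, 1 ≤ k → k ≤ ND.s → ∀ j, ND.d (k - 1) ≤ j → j < ND.d k → f j = ND.lam k) :
    ∀ k ≤ ND.s, ((q : ℝ) - 1) * ∑ j ∈ Finset.range (ND.d k), (q : ℝ) ^ j * f j =
      degK K q θ - degK K q (Acoef K θ A (ND.d k)) := by
  intro k
  induction k with
  | zero => intro _; simp [ND.d_zero, Acoef]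
  | succ k ih =>
    intro hk
    have hlt := ND.d_mono k (by omega)
    have hq' : (1 : ℝ) < q := by exact_mod_cast hq
    rw [← Finset.sum_range_add_sum_Ico _ hlt.le, mul_add, ih (by omega)]
    have h1 : ∑ j ∈ Finset.Ico (ND.d k) (ND.d (k + 1)), (q : ℝ) ^ j * f j =
        (∑ j ∈ Finset.Ico (ND.d k) (ND.d (k + 1)), (q : ℝ) ^ j) * ND.lam (k + 1) := by
      rw [Finset.sum_mul]
      refine Finset.sum_congr rfl fun j hj => ?_
      rw [Finset.mem_Ico] at hj
      rw [hf (k + 1) (by omega) hk j (by simpa using hj.1) hj.2]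
    have hpos : (q : ℝ) ^ ND.d k < (q : ℝ) ^ ND.d (k + 1) := pow_lt_pow_right₀ hq' hlt
    rw [h1, geom_sum_Ico hq'.ne' hlt.le, ND.slope_eq (k + 1) (by omega) hk]
    have h2 : (q : ℝ) - 1 ≠ 0 := by linarith
    have h3 : (q : ℝ) ^ ND.d (k + 1) - (q : ℝ) ^ ND.d k ≠ 0 := by linarith
    simp only [Nat.add_sub_cancel]
    field_simp
    ring

theorem stmt14
    (𝕂 : Type) [NontriviallyNormedField 𝕂] [CompleteSpace 𝕂] [IsAlgClosed 𝕂]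
    (hna : ∀ x y : 𝕂, ‖x + y‖ ≤ max ‖x‖ ‖y‖)
    (p e q : ℕ) (hp : p.Prime) (hcharp : CharP 𝕂 p) (he : 0 < e) (hqpe : q = p ^ e)
    (θ : 𝕂) (hθ : ‖θ‖ = (q : ℝ))
    (r : ℕ) (hr : 0 < r) (A : ℕ → 𝕂) (hAr : A r ≠ 0)
    (ND : NewtonData 𝕂 q r θ A)
    (x : Fin r → 𝕂) (hxb : IsFqBasis 𝕂 q r θ A x) (hxs : IsStrict 𝕂 q r θ A ND x)
    :
    (Matrix.of fun i j : Fin r => x j ^ q ^ (i : ℕ)).det ≠ 0 ∧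
      degK 𝕂 q (Matrix.of fun i j : Fin r => x j ^ q ^ (i : ℕ)).det =
        ∑ j : Fin r, (q : ℝ) ^ (j : ℕ) * degK 𝕂 q (x j) := by
  haveI : Fact p.Prime := ⟨hp⟩
  have hq : 1 < q := hqpe ▸ Nat.one_lt_pow he.ne' hp.one_lt
  have hq' : (1 : ℝ) < q := by exact_mod_cast hq
  haveI : ExpChar 𝕂 p := ExpChar.prime hp
  have hF : ∀ y, iterateFrobenius 𝕂 p e y = y ^ q := by
    intro y
    rw [iterateFrobenius_def, hqpe]
  have hθ0 : θ ≠ 0 := by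
    rw [← norm_ne_zero_iff, hθ]
    linarith
  have hne := moore_det_ne_zero 𝕂 q r _ hF (by omega) θ hθ0 A x hxb
  refine ⟨hne, ?_⟩
  have hn := moore_det_norm 𝕂 q r _ hF hr θ A hAr x hxb.1
  set D := (Matrix.of fun i j : Fin r => x j ^ q ^ (i : ℕ)).det
  have hD : ‖D‖ ≠ 0 := norm_ne_zero_iff.mpr hne
  have h1 := congrArg (Real.logb q) hn
  rw [Real.logb_mul (pow_ne_zero _ hD) (norm_ne_zero_iff.mpr hAr),
    Real.logb_mul (norm_ne_zero_iff.mpr hθ0) hD, Real.logb_pow] at h1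
  have h2 := newton_sum 𝕂 q r hq θ A ND
    (fun j => if h : j < r then degK 𝕂 q (x ⟨j, h⟩) else 0) (by
      intro k hk1 hks j hj1 hj2
      have hdm : ∀ m, k + m ≤ ND.s → ND.d k ≤ ND.d (k + m) := by
        intro m
        induction m with
        | zero => intro _; exact le_rfl
        | succ m ih =>
          intro hm
          exact (ih (by omega)).trans (ND.d_mono (k + m) (by omega)).le
      have hjr : j < r := by
        have := hdm (ND.s - k) (by omega)
        rw [show k + (ND.s - k) = ND.s by omega, ND.d_last] at this
        omega
      simp only [hjr, dif_pos]
      exact hxs k hk1 hks ⟨j, hjr⟩ hj1 hj2) ND.s le_rfl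
  rw [ND.d_last, ← Fin.sum_univ_eq_sum_range
    (fun j => (q : ℝ) ^ j * (if h : j < r then degK 𝕂 q (x ⟨j, h⟩) else 0))] at h2
  simp only [Fin.is_lt, dif_pos, Fin.eta, Acoef, hr.ne', if_false] at h2
  have h3 : (q : ℝ) - 1 ≠ 0 := by linarith
  apply mul_left_cancel₀ h3
  rw [h2]
  simp only [degK]
  linarith

end DrinfeldRAT
end
end
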